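/- arXiv:2106.13317 — 3 statements merged into one kernel-verified Lean document; each statement's English description precedes it below -/
import Mathlib

section
/- Let b ∈ (0,∞], α ∈ ℝ, and let q : (0,b) → ℝ be measurable and locally integrable. If there exists x₁ ∈ (0,b) such that q(x) ≥ (3/4 − α/2)·x^(α−2) for a.e. x ∈ (0,x₁), then the differential expression τ_α = −(d/dx) x^α (d/dx) + q(x) is nonoscillatory at x = 0 and in the limit point case at x = 0. -/
noncomputable section

open MeasureTheory Set
open scoped ENNReal NNReal

/-- The interval `(0, b)` for `b ∈ (0, ∞]`, with `b` an extended nonnegative real. -/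
def Iob (b : ℝ≥0∞) : Set ℝ := {x : ℝ | 0 < x ∧ ENNReal.ofReal x < b}

/-- `(u, v)` is a (complex-valued) solution of `τ_α u = z u` on `(0, b)`, where
`τ_α = -(d/dx) x^α (d/dx) + q(x)` and `v` plays the role of the quasi-derivative `x^α u'`. -/
def IsSolutionC (b : ℝ≥0∞) (α : ℝ) (q : ℝ → ℝ) (z : ℂ) (u v : ℝ → ℂ) : Prop :=
  ∀ x ∈ Iob b, ∀ x₀ ∈ Iob b,
    (u x = u x₀ + ∫ t in x₀..x, ((t ^ (-α) : ℝ) : ℂ) * v t) ∧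
    (v x = v x₀ + ∫ t in x₀..x, ((q t : ℂ) - z) * u t)

/-- `(u, v)` is a real-valued solution of `τ_α u = λ u` on `(0, b)`. -/
def IsSolutionR (b : ℝ≥0∞) (α : ℝ) (q : ℝ → ℝ) (lam : ℝ) (u v : ℝ → ℝ) : Prop :=
  ∀ x ∈ Iob b, ∀ x₀ ∈ Iob b,
    (u x = u x₀ + ∫ t in x₀..x, (t ^ (-α)) * v t) ∧
    (v x = v x₀ + ∫ t in x₀..x, (q t - lam) * u t)

/-- `τ_α` is in the limit point case at `x = 0`: for every `z ∈ ℂ` there is a solution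
of `τ_α u = z u` which is not square-integrable near `0`. -/
def LimitPointAtZero (b : ℝ≥0∞) (α : ℝ) (q : ℝ → ℝ) : Prop :=
  ∀ z : ℂ, ∃ u v : ℝ → ℂ, IsSolutionC b α q z u v ∧
    ∃ c ∈ Iob b, (∫⁻ x in Ioo (0 : ℝ) c, (‖u x‖₊ : ℝ≥0∞) ^ 2) = ⊤

/-- `τ_α` is nonoscillatory at `x = 0`: there is a nontrivial real-valued solution of
`τ_α u = 0` having finitely many zeros in `(0, c)` for some `c ∈ (0, b)`. -/
def NonoscillatoryAtZero (b : ℝ≥0∞) (α : ℝ) (q : ℝ → ℝ) : Prop :=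
  ∃ u v : ℝ → ℝ, IsSolutionR b α q 0 u v ∧ (¬ ∀ x ∈ Iob b, u x = 0 ∧ v x = 0) ∧
    ∃ c ∈ Iob b, {x ∈ Ioo (0 : ℝ) c | u x = 0}.Finite

/-- `f'` is interval integrable between any two points of `S`, and `f` is a primitive of it
there: the increments of `f` on `S` are the integrals of `f'`. -/
def PrimitiveOn {E : Type*} [NormedAddCommGroup E] [NormedSpace ℝ E] (S : Set ℝ)
    (f f' : ℝ → E) : Prop :=
  ∀ x ∈ S, ∀ y ∈ S, IntervalIntegrable f' volume x y ∧ ∫ t in x..y, f' t = f y - f x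

namespace PrimitiveOn

variable {E : Type*} [NormedAddCommGroup E] [NormedSpace ℝ E] {S : Set ℝ}

lemma of_integral {f' : ℝ → E} {x₀ : ℝ} (hx₀ : x₀ ∈ S)
    (h : ∀ x ∈ S, ∀ y ∈ S, IntervalIntegrable f' volume x y) (C : E) :
    PrimitiveOn S (fun x => C + ∫ t in x₀..x, f' t) f' := by
  intro x hx y hy
  refine ⟨h x hx y hy, ?_⟩
  rw [add_sub_add_left_eq_sub]
  exact (intervalIntegral.integral_interval_sub_left (h _ hx₀ _ hy) (h _ hx₀ _ hx)).symm

lemma eq_add {f f' : ℝ → E} (h : PrimitiveOn S f f') {x y : ℝ} (hx : x ∈ S) (hy : y ∈ S) :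
    f y = f x + ∫ t in x..y, f' t := by
  rw [(h x hx y hy).2]; abel

lemma congr [OrdConnected S] {f f' g' : ℝ → E} (h : PrimitiveOn S f f') (hg : EqOn f' g' S) :
    PrimitiveOn S f g' := by
  intro x hx y hy
  have hsub : uIoc x y ⊆ S := uIoc_subset_uIcc.trans (OrdConnected.uIcc_subset ‹_› hx hy)
  refine ⟨(h x hx y hy).1.congr fun t ht => hg (hsub ht), ?_⟩
  rw [← (h x hx y hy).2]
  refine intervalIntegral.integral_congr_ae (Filter.Eventually.of_forall fun t ht => ?_)
  exact (hg (hsub ht)).symm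

lemma continuousOn [OrdConnected S] (hS : IsOpen S) {f f' : ℝ → E} (h : PrimitiveOn S f f') :
    ContinuousOn f S := by
  intro x hx
  obtain ⟨ε, hε, hball⟩ := Metric.nhds_basis_closedBall.mem_iff.1 (hS.mem_nhds hx)
  rw [Real.closedBall_eq_Icc] at hball
  have ha : x - ε ∈ S := hball ⟨le_rfl, by linarith⟩
  have hb : x + ε ∈ S := hball ⟨by linarith, le_rfl⟩
  have hab : x - ε ≤ x + ε := by linarith
  have hc : ContinuousOn (fun y => f (x - ε) + ∫ t in (x - ε)..y, f' t) (Icc (x - ε) (x + ε)) := by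
    have := intervalIntegral.continuousOn_primitive_interval' (h _ ha _ hb).1 left_mem_uIcc
    rw [uIcc_of_le hab] at this
    exact continuousOn_const.add this
  have hc' : ContinuousOn f (Icc (x - ε) (x + ε)) :=
    hc.congr fun y hy => h.eq_add ha (hball hy)
  exact (hc'.continuousAt (Icc_mem_nhds (by linarith) (by linarith))).continuousWithinAt

lemma add {f f' g g' : ℝ → E} (hf : PrimitiveOn S f f') (hg : PrimitiveOn S g g') :
    PrimitiveOn S (fun x => f x + g x) (fun x => f' x + g' x) := by
  intro x hx y hy
  obtain ⟨h1, h2⟩ := hf x hx y hy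
  obtain ⟨h3, h4⟩ := hg x hx y hy
  refine ⟨h1.add h3, ?_⟩
  rw [intervalIntegral.integral_add h1 h3, h2, h4]
  exact sub_add_sub_comm _ _ _ _

lemma sub {f f' g g' : ℝ → E} (hf : PrimitiveOn S f f') (hg : PrimitiveOn S g g') :
    PrimitiveOn S (fun x => f x - g x) (fun x => f' x - g' x) := by
  intro x hx y hy
  obtain ⟨h1, h2⟩ := hf x hx y hy
  obtain ⟨h3, h4⟩ := hg x hx y hy
  refine ⟨h1.sub h3, ?_⟩
  rw [intervalIntegral.integral_sub h1 h3, h2, h4]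
  exact sub_sub_sub_comm _ _ _ _

lemma of_hasDerivAt [OrdConnected S] {f f' : ℝ → E} [CompleteSpace E]
    (h : ∀ x ∈ S, HasDerivAt f (f' x) x) (hf' : ContinuousOn f' S) : PrimitiveOn S f f' := by
  intro x hx y hy
  have hsub := OrdConnected.uIcc_subset ‹_› hx hy
  have hi : IntervalIntegrable f' volume x y := (hf'.mono hsub).intervalIntegrable
  exact ⟨hi, intervalIntegral.integral_eq_sub_of_hasDerivAt (fun t ht => h t (hsub ht)) hi⟩

lemma clm_comp {F : Type*} [NormedAddCommGroup F] [NormedSpace ℝ F] [CompleteSpace E]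
    [CompleteSpace F] (L : E →L[ℝ] F)
    {f f' : ℝ → E} (h : PrimitiveOn S f f') :
    PrimitiveOn S (fun x => L (f x)) (fun x => L (f' x)) := by
  intro x hx y hy
  obtain ⟨h1, h2⟩ := h x hx y hy
  exact ⟨⟨L.integrable_comp h1.1, L.integrable_comp h1.2⟩, by
    rw [L.intervalIntegral_comp_comm h1, h2, map_sub]⟩

lemma mul [OrdConnected S] {f f' g g' : ℝ → ℝ} (hf : PrimitiveOn S f f')
    (hg : PrimitiveOn S g g') :
    PrimitiveOn S (fun x => f x * g x) (fun x => f' x * g x + f x * g' x) := by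
  intro x hx y hy
  have hsub := OrdConnected.uIcc_subset ‹_› hx hy
  obtain ⟨hfi, hfe⟩ := hf x hx y hy
  obtain ⟨hgi, hge⟩ := hg x hx y hy
  set F : ℝ → ℝ := fun s => f x + ∫ t in x..s, f' t with hF
  set G : ℝ → ℝ := fun s => g x + ∫ t in x..s, g' t with hG
  have hFf : ∀ s ∈ uIcc x y, F s = f s := fun s hs => (hf.eq_add hx (hsub hs)).symm
  have hGg : ∀ s ∈ uIcc x y, G s = g s := fun s hs => (hg.eq_add hx (hsub hs)).symm
  have hc : ∀ C : ℝ, AbsolutelyContinuousOnInterval (fun _ : ℝ => C) x y := fun C =>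
    (LipschitzWith.const C).lipschitzOnWith.absolutelyContinuousOnInterval
  have hFac : AbsolutelyContinuousOnInterval F x y :=
    (hc _).add (hfi.absolutelyContinuousOnInterval_intervalIntegral left_mem_uIcc)
  have hGac : AbsolutelyContinuousOnInterval G x y :=
    (hc _).add (hgi.absolutelyContinuousOnInterval_intervalIntegral left_mem_uIcc)
  have hae : ∀ᵐ t, t ∈ uIoc x y →
      deriv F t * G t + F t * deriv G t = f' t * g t + f t * g' t := by
    filter_upwards [hfi.ae_hasDerivAt_integral, hgi.ae_hasDerivAt_integral] with t h1 h2 ht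
    have ht' := uIoc_subset_uIcc ht
    rw [((h1 ht' x left_mem_uIcc).const_add (f x)).deriv,
      ((h2 ht' x left_mem_uIcc).const_add (g x)).deriv, hFf t ht', hGg t ht']
  constructor
  · have h1 : IntervalIntegrable (fun t => f' t * G t + F t * g' t) volume x y :=
      (hfi.mul_continuousOn hGac.continuousOn).add (hgi.continuousOn_mul hFac.continuousOn)
    refine h1.congr fun t ht => ?_
    have ht' := uIoc_subset_uIcc ht
    simp only [hFf t ht', hGg t ht']
  · rw [← intervalIntegral.integral_congr_ae hae, hFac.integral_deriv_mul_eq_sub hGac,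
      hFf y right_mem_uIcc, hGg y right_mem_uIcc, hFf x left_mem_uIcc, hGg x left_mem_uIcc]

lemma mul_complex [OrdConnected S] {f f' g g' : ℝ → ℂ} (hf : PrimitiveOn S f f')
    (hg : PrimitiveOn S g g') :
    PrimitiveOn S (fun x => f x * g x) (fun x => f' x * g x + f x * g' x) := by
  have fr : PrimitiveOn S (fun x => (f x).re) (fun x => (f' x).re) := hf.clm_comp Complex.reCLM
  have fi : PrimitiveOn S (fun x => (f x).im) (fun x => (f' x).im) := hf.clm_comp Complex.imCLM
  have gr : PrimitiveOn S (fun x => (g x).re) (fun x => (g' x).re) := hg.clm_comp Complex.reCLM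
  have gi : PrimitiveOn S (fun x => (g x).im) (fun x => (g' x).im) := hg.clm_comp Complex.imCLM
  have hr := ((fr.mul gr).sub (fi.mul gi)).clm_comp Complex.ofRealCLM
  have hi := (((fr.mul gi).add (fi.mul gr)).clm_comp Complex.ofRealCLM).clm_comp
    ((ContinuousLinearMap.mul ℝ ℂ) Complex.I)
  convert hr.add hi using 2 with t t <;>
  · apply Complex.ext <;> simp <;> ring

lemma pow [OrdConnected S] {f f' : ℝ → ℝ} (hf : PrimitiveOn S f f') (n : ℕ) :
    PrimitiveOn S (fun x => f x ^ (n + 1)) (fun x => (n + 1) * (f x ^ n * f' x)) := by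
  induction n with
  | zero => simpa using hf
  | succ n ih =>
    convert ih.mul hf using 2 with t t <;>
    · push_cast
      ring

end PrimitiveOn

section LinearSystem

variable {E : Type*} [NormedAddCommGroup E] [NormedSpace ℝ E] {S : Set ℝ}

lemma IntervalIntegrable.clm_apply_continuousOn {A : ℝ → E →L[ℝ] E} {f : ℝ → E} {x y : ℝ}
    (hA : IntervalIntegrable A volume x y) (hf : ContinuousOn f (uIcc x y)) :
    IntervalIntegrable (fun t => A t (f t)) volume x y := by
  rw [intervalIntegrable_iff] at hA ⊢
  obtain ⟨M, hM⟩ := isCompact_uIcc.exists_bound_of_continuousOn hf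
  have hfm : AEStronglyMeasurable f (volume.restrict (uIoc x y)) :=
    (hf.mono uIoc_subset_uIcc).aestronglyMeasurable measurableSet_uIoc
  refine (hA.norm.mul_const M).mono' ?_ ?_
  · exact (ContinuousLinearMap.apply ℝ E).aestronglyMeasurable_comp₂ hfm hA.aestronglyMeasurable
  · refine (ae_restrict_iff' measurableSet_uIoc).2 (Filter.Eventually.of_forall fun t ht => ?_)
    exact (A t).le_opNorm_of_le (hM t (uIoc_subset_uIcc ht))

lemma abs_integral_mul_abs_primitive_pow [OrdConnected S] {k : ℝ → ℝ} (hk0 : ∀ t, 0 ≤ k t)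
    (hk : ∀ x ∈ S, ∀ y ∈ S, IntervalIntegrable k volume x y) {x₀ x : ℝ} (hx₀ : x₀ ∈ S)
    (hx : x ∈ S) (n : ℕ) :
    |∫ t in x₀..x, k t * |∫ s in x₀..t, k s| ^ n| = |∫ t in x₀..x, k t| ^ (n + 1) / (n + 1) := by
  have hK : PrimitiveOn S (fun t => ∫ s in x₀..t, k s) k := by
    simpa using PrimitiveOn.of_integral hx₀ hk 0
  have h := (hK.pow n x₀ hx₀ x hx).2
  rw [intervalIntegral.integral_const_mul] at h
  simp only [intervalIntegral.integral_same, ne_eq, Nat.add_eq_zero_iff, one_ne_zero, and_false,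
    not_false_eq_true, zero_pow, sub_zero] at h
  have hn : (0 : ℝ) < n + 1 := by positivity
  have key : |∫ t in x₀..x, k t * |∫ s in x₀..t, k s| ^ n|
      = |∫ t in x₀..x, (∫ s in x₀..t, k s) ^ n * k t| := by
    rcases le_total x₀ x with hle | hle
    · congr 1
      refine intervalIntegral.integral_congr fun t ht => ?_
      rw [uIcc_of_le hle] at ht
      have : 0 ≤ ∫ s in x₀..t, k s := intervalIntegral.integral_nonneg ht.1 fun s _ => hk0 s
      simp only [abs_of_nonneg this, mul_comm]
    · have : ∫ t in x₀..x, k t * |∫ s in x₀..t, k s| ^ n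
          = (-1) ^ n * ∫ t in x₀..x, (∫ s in x₀..t, k s) ^ n * k t := by
        rw [← intervalIntegral.integral_const_mul]
        refine intervalIntegral.integral_congr fun t ht => ?_
        rw [uIcc_of_ge hle] at ht
        have : ∫ s in x₀..t, k s ≤ 0 := by
          rw [intervalIntegral.integral_symm, neg_nonpos]
          exact intervalIntegral.integral_nonneg ht.2 fun s _ => hk0 s
        simp only [abs_of_nonpos this]
        rw [neg_pow]
        ring
      rw [this, abs_mul]
      simp
  rw [key, eq_div_iff hn.ne', ← abs_pow, ← h, abs_mul, abs_of_pos hn]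
  ring

/-- Existence for linear systems `y' = A y` with locally integrable coefficients. -/
lemma exists_primitiveOn_linear [CompleteSpace E] [OrdConnected S] (hS : IsOpen S)
    {A : ℝ → E →L[ℝ] E} (hA : ∀ x ∈ S, ∀ y ∈ S, IntervalIntegrable A volume x y) {x₀ : ℝ}
    (hx₀ : x₀ ∈ S) (y₀ : E) :
    ∃ y : ℝ → E, y x₀ = y₀ ∧ PrimitiveOn S y (fun t => A t (y t)) := by
  have hsub : ∀ x ∈ S, ∀ y ∈ S, uIcc x y ⊆ S := fun x hx y hy =>
    OrdConnected.uIcc_subset ‹_› hx hy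
  set K : ℝ → ℝ := fun x => ∫ t in x₀..x, ‖A t‖ with hK
  have hAn : ∀ x ∈ S, ∀ y ∈ S, IntervalIntegrable (fun t => ‖A t‖) volume x y :=
    fun x hx y hy => (hA x hx y hy).norm
  have hKc : ContinuousOn K S := by
    have := (PrimitiveOn.of_integral hx₀ hAn 0).continuousOn hS
    simpa using this
  let Y : ℕ → ℝ → E := fun n => n.rec (fun _ => y₀) fun _ f x => ∫ t in x₀..x, A t (f t)
  have hYs : ∀ n x, Y (n + 1) x = ∫ t in x₀..x, A t (Y n t) := fun _ _ => rfl
  have hYc : ∀ n, ContinuousOn (Y n) S := by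
    intro n
    induction n with
    | zero => exact continuousOn_const
    | succ n ih =>
      have := (PrimitiveOn.of_integral hx₀ (fun x hx y hy =>
        (hA x hx y hy).clm_apply_continuousOn (ih.mono (hsub x hx y hy))) 0).continuousOn hS
      simpa using this
  have hYb : ∀ n, ∀ x ∈ S, ‖Y n x‖ ≤ ‖y₀‖ * (|K x| ^ n / n.factorial) := by
    intro n
    induction n with
    | zero => intro x _; simp [Y]
    | succ n ih =>
      intro x hx
      rw [hYs]
      have hint : IntervalIntegrable (fun t => (‖y₀‖ / n.factorial) * (‖A t‖ * |K t| ^ n))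
          volume x₀ x :=
        ((hAn x₀ hx₀ x hx).mul_continuousOn
          ((hKc.mono (hsub _ hx₀ _ hx)).abs.pow n)).const_mul _
      refine (intervalIntegral.norm_integral_le_abs_of_norm_le ?_ hint).trans (le_of_eq ?_)
      · refine (ae_restrict_iff' measurableSet_uIoc).2 (Filter.Eventually.of_forall fun t ht => ?_)
        have htS := hsub _ hx₀ _ hx (uIoc_subset_uIcc ht)
        refine ((A t).le_opNorm_of_le (ih t htS)).trans (le_of_eq ?_)
        ring
      · rw [intervalIntegral.integral_const_mul, abs_mul,
          abs_integral_mul_abs_primitive_pow (fun t => norm_nonneg (A t)) hAn hx₀ hx n,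
          abs_of_nonneg (by positivity), Nat.factorial_succ]
        push_cast
        field_simp
        rfl
  have hmaj : ∀ x ∈ S, ∀ z ∈ S, ∃ M : ℝ, ∀ n, ∀ t ∈ uIcc x z,
      ‖Y n t‖ ≤ ‖y₀‖ * (M ^ n / n.factorial) := by
    intro x hx z hz
    obtain ⟨M, hM⟩ := isCompact_uIcc.exists_bound_of_continuousOn (hKc.mono (hsub _ hx _ hz))
    refine ⟨M, fun n t ht => (hYb n t (hsub _ hx _ hz ht)).trans ?_⟩
    have := hM t ht
    rw [Real.norm_eq_abs] at this
    gcongr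
  have hsm : ∀ M : ℝ, Summable fun n : ℕ => ‖y₀‖ * (M ^ n / n.factorial) := fun M =>
    (Real.summable_pow_div_factorial M).mul_left _
  set y : ℝ → E := fun x => ∑' n, Y n x with hy
  have hyc : ∀ x ∈ S, ∀ z ∈ S, ContinuousOn y (uIcc x z) := by
    intro x hx z hz
    obtain ⟨M, hM⟩ := hmaj x hx z hz
    exact continuousOn_tsum (fun n => (hYc n).mono (hsub _ hx _ hz)) (hsm M) hM
  have hsum : ∀ x ∈ S, HasSum (fun n => Y n x) (y x) := by
    intro x hx
    obtain ⟨M, hM⟩ := hmaj x hx x hx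
    exact (Summable.of_norm_bounded (hsm M) fun n => hM n x left_mem_uIcc).hasSum
  have hAy : ∀ x ∈ S, ∀ z ∈ S, IntervalIntegrable (fun t => A t (y t)) volume x z :=
    fun x hx z hz => (hA x hx z hz).clm_apply_continuousOn (hyc x hx z hz)
  have heq : ∀ x ∈ S, y x = y₀ + ∫ t in x₀..x, A t (y t) := by
    intro x hx
    obtain ⟨M, hM⟩ := hmaj x₀ hx₀ x hx
    have h1 : HasSum (fun n => ∫ t in x₀..x, A t (Y n t)) (∫ t in x₀..x, A t (y t)) := by
      refine intervalIntegral.hasSum_integral_of_dominated_convergence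
        (fun n t => ‖A t‖ * (‖y₀‖ * (M ^ n / n.factorial))) (fun n => ?_) (fun n => ?_) ?_ ?_ ?_
      · exact ((hA _ hx₀ _ hx).clm_apply_continuousOn
          ((hYc n).mono (hsub _ hx₀ _ hx))).def'.aestronglyMeasurable
      · exact Filter.Eventually.of_forall fun t ht =>
          (A t).le_opNorm_of_le (hM n t (uIoc_subset_uIcc ht))
      · exact Filter.Eventually.of_forall fun t _ => (hsm M).mul_left _
      · simp only [tsum_mul_left]
        exact (hAn _ hx₀ _ hx).mul_const _
      · exact Filter.Eventually.of_forall fun t ht =>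
          (A t).hasSum (hsum t (hsub _ hx₀ _ hx (uIoc_subset_uIcc ht)))
    have h2 := (hasSum_nat_add_iff' 1).2 (hsum x hx)
    simp only [Finset.range_one, Finset.sum_singleton] at h2
    have h3 : y x - y₀ = ∫ t in x₀..x, A t (y t) := h2.unique h1
    rw [← h3]
    abel
  refine ⟨y, by simpa using heq x₀ hx₀, fun x hx z hz => ⟨hAy x hx z hz, ?_⟩⟩
  rw [heq x hx, heq z hz, add_sub_add_left_eq_sub]
  exact (intervalIntegral.integral_interval_sub_left (hAy _ hx₀ _ hz) (hAy _ hx₀ _ hx)).symm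

lemma exists_primitiveOn_system [OrdConnected S] (hS : IsOpen S) {p r : ℝ → ℂ}
    (hp : ∀ x ∈ S, ∀ y ∈ S, IntervalIntegrable p volume x y)
    (hr : ∀ x ∈ S, ∀ y ∈ S, IntervalIntegrable r volume x y) {x₀ : ℝ} (hx₀ : x₀ ∈ S) (a b : ℂ) :
    ∃ u v : ℝ → ℂ, u x₀ = a ∧ v x₀ = b ∧ PrimitiveOn S u (fun t => p t * v t) ∧
      PrimitiveOn S v (fun t => r t * u t) := by
  let L₁ : ℂ × ℂ →L[ℝ] ℂ × ℂ :=
    (ContinuousLinearMap.inl ℝ ℂ ℂ).comp (ContinuousLinearMap.snd ℝ ℂ ℂ)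
  let L₂ : ℂ × ℂ →L[ℝ] ℂ × ℂ :=
    (ContinuousLinearMap.inr ℝ ℂ ℂ).comp (ContinuousLinearMap.fst ℝ ℂ ℂ)
  have hA : ∀ x ∈ S, ∀ y ∈ S,
      IntervalIntegrable (fun t => p t • L₁ + r t • L₂) volume x y := fun x hx y hy =>
    IntervalIntegrable.add
      ⟨(hp x hx y hy).1.smul_const L₁, (hp x hx y hy).2.smul_const L₁⟩
      ⟨(hr x hx y hy).1.smul_const L₂, (hr x hx y hy).2.smul_const L₂⟩
  obtain ⟨y, hy0, hy⟩ := exists_primitiveOn_linear hS hA hx₀ (a, b)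
  refine ⟨fun t => (y t).1, fun t => (y t).2, by simp [hy0], by simp [hy0], ?_, ?_⟩
  · simpa [L₁, L₂] using hy.clm_comp (ContinuousLinearMap.fst ℝ ℂ ℂ)
  · simpa [L₁, L₂] using hy.clm_comp (ContinuousLinearMap.snd ℝ ℂ ℂ)

end LinearSystem

/-- Weyl's alternative: if two solutions of `(p, q - z)` with Wronskian one are square integrable
near `0`, then so is every solution of `(p, q)`. -/
lemma exists_integrableOn_sq_of_fundamental_system {S : Set ℝ} [OrdConnected S] (hS : IsOpen S)
    {p q : ℝ → ℂ} {z : ℂ} {u v φ φ' ψ ψ' : ℝ → ℂ}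
    (hu : PrimitiveOn S u fun t => p t * v t) (hv : PrimitiveOn S v fun t => q t * u t)
    (hφ : PrimitiveOn S φ fun t => p t * φ' t)
    (hφ' : PrimitiveOn S φ' fun t => (q t - z) * φ t)
    (hψ : PrimitiveOn S ψ fun t => p t * ψ' t)
    (hψ' : PrimitiveOn S ψ' fun t => (q t - z) * ψ t)
    {c : ℝ} (hc : 0 < c) (hcS : Ioc 0 c ⊆ S) (hW : φ c * ψ' c - φ' c * ψ c = 1)
    (hφi : IntegrableOn (fun t => ‖φ t‖ ^ 2) (Ioo 0 c))
    (hψi : IntegrableOn (fun t => ‖ψ t‖ ^ 2) (Ioo 0 c)) :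
    ∃ d ∈ Ioc 0 c, IntegrableOn (fun t => ‖u t‖ ^ 2) (Ioo 0 d) := by
  have hcmem : c ∈ S := hcS ⟨hc, le_rfl⟩
  have huc := hu.continuousOn hS
  have hφc := hφ.continuousOn hS
  have hψc := hψ.continuousOn hS
  have hW1 : ∀ x ∈ S, φ x * ψ' x - φ' x * ψ x = 1 := by
    intro x hx
    have h : PrimitiveOn S (fun x => φ x * ψ' x - φ' x * ψ x) (fun _ => 0) :=
      ((hφ.mul_complex hψ').sub (hφ'.mul_complex hψ)).congr fun t _ => by ring
    simpa [hW] using h.eq_add hcmem hx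
  set A : ℝ → ℂ := fun x => u x * ψ' x - v x * ψ x with hAdef
  set B : ℝ → ℂ := fun x => φ x * v x - φ' x * u x with hBdef
  have hA : PrimitiveOn S A (fun t => -(z * u t * ψ t)) :=
    ((hu.mul_complex hψ').sub (hv.mul_complex hψ)).congr fun t _ => by ring
  have hB : PrimitiveOn S B (fun t => z * u t * φ t) :=
    ((hφ.mul_complex hv).sub (hφ'.mul_complex hu)).congr fun t _ => by ring
  have huAB : ∀ x ∈ S, u x = A x * φ x + B x * ψ x := fun x hx => by
    linear_combination (-u x) * hW1 x hx
  set g : ℝ → ℝ := fun t => ‖φ t‖ + ‖ψ t‖ with hg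
  have hgc : ContinuousOn g S := hφc.norm.add hψc.norm
  have hg0 : ∀ t, 0 ≤ g t := fun t => by positivity
  have hIooS : Ioo 0 c ⊆ S := Ioo_subset_Ioc_self.trans hcS
  have hgi : IntegrableOn (fun t => g t ^ 2) (Ioo 0 c) := by
    refine ((hφi.add hψi).const_mul 2).mono'
      ((hgc.pow 2).mono hIooS |>.aestronglyMeasurable measurableSet_Ioo)
      (Filter.Eventually.of_forall fun t => ?_)
    rw [Real.norm_of_nonneg (by positivity)]
    simp only [hg, Pi.add_apply]
    nlinarith [sq_nonneg (‖φ t‖ - ‖ψ t‖)]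
  set h : ℝ → ℝ := fun t => ‖z‖ * g t ^ 2 with hh
  have hh0 : ∀ t, 0 ≤ h t := fun t => by positivity
  have hhi : IntervalIntegrable h volume 0 c := by
    rw [intervalIntegrable_iff_integrableOn_Ioo_of_le hc.le]
    exact hgi.const_mul _
  obtain ⟨d, ⟨hd0, hdc⟩, hd⟩ : ∃ d ∈ Ioo 0 c, ∫ t in 0..d, h t < 1 / 2 := by
    have h1 := intervalIntegral.continuousOn_primitive_interval' hhi left_mem_uIcc 0 left_mem_uIcc
    rw [uIcc_of_le hc.le] at h1
    have h2 := (h1.mono (Ioo_subset_Icc_self)).eventually_lt_const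
      (show ∫ t in (0 : ℝ)..0, h t < 1 / 2 by simp)
    rw [nhdsWithin_Ioo_eq_nhdsGT hc] at h2
    exact ((Filter.eventually_mem_set.2 (Ioo_mem_nhdsGT hc)).and h2).exists
  have hdS : d ∈ S := hIooS ⟨hd0, hdc⟩
  set N : ℝ → ℝ := fun x => ‖A x‖ + ‖B x‖ with hN
  have hNc : ContinuousOn N S := (hA.continuousOn hS).norm.add (hB.continuousOn hS).norm
  have hN0 : ∀ t, 0 ≤ N t := fun t => by positivity
  have huN : ∀ x ∈ S, ‖u x‖ ≤ N x * g x := by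
    intro x hx
    rw [huAB x hx]
    refine (norm_add_le _ _).trans ?_
    rw [norm_mul, norm_mul]
    have := mul_nonneg (norm_nonneg (A x)) (norm_nonneg (ψ x))
    have := mul_nonneg (norm_nonneg (B x)) (norm_nonneg (φ x))
    simp only [hN, hg]
    nlinarith
  have hNd : ∀ x ∈ Ioo 0 d, N x ≤ 2 * N d := by
    intro x hx
    have hIcc : Icc x d ⊆ S := fun t ht => hIooS ⟨hx.1.trans_le ht.1, ht.2.trans_lt hdc⟩
    obtain ⟨y, hy, hmax⟩ := isCompact_Icc.exists_isMaxOn (nonempty_Icc.2 hx.2.le)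
      (hNc.mono hIcc)
    have hyS := hIcc hy
    have hyd : uIcc y d ⊆ S := by
      rw [uIcc_of_le hy.2]
      exact (Icc_subset_Icc_left hy.1).trans hIcc
    have hbound : ∀ f : ℝ → ℂ, ContinuousOn f S → IntervalIntegrable
        (fun t => ‖z‖ * (N y * g t) * ‖f t‖) volume y d := fun f hf =>
      (((continuousOn_const.mul (continuousOn_const.mul hgc)).mul hf.norm).mono
        hyd).intervalIntegrable
    have hut : ∀ t ∈ Ioc y d, ‖u t‖ ≤ N y * g t := fun t ht => by
      have htI : t ∈ Icc x d := ⟨hy.1.trans ht.1.le, ht.2⟩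
      exact (huN t (hIcc htI)).trans (mul_le_mul_of_nonneg_right (hmax htI) (hg0 t))
    have hAy : ‖A y‖ ≤ ‖A d‖ + ∫ t in y..d, ‖z‖ * (N y * g t) * ‖ψ t‖ := by
      have h1 : A y = A d - ∫ t in y..d, -(z * u t * ψ t) := by
        rw [(hA y hyS d hdS).2]; ring
      rw [h1]
      refine (norm_sub_le _ _).trans (add_le_add_right ?_ _)
      refine intervalIntegral.norm_integral_le_of_norm_le hy.2
        (Filter.Eventually.of_forall fun t ht => ?_) (hbound ψ hψc)
      rw [norm_neg, norm_mul, norm_mul]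
      gcongr
      exact hut t ht
    have hBy : ‖B y‖ ≤ ‖B d‖ + ∫ t in y..d, ‖z‖ * (N y * g t) * ‖φ t‖ := by
      have h1 : B y = B d - ∫ t in y..d, z * u t * φ t := by
        rw [(hB y hyS d hdS).2]; ring
      rw [h1]
      refine (norm_sub_le _ _).trans (add_le_add_right ?_ _)
      refine intervalIntegral.norm_integral_le_of_norm_le hy.2
        (Filter.Eventually.of_forall fun t ht => ?_) (hbound φ hφc)
      rw [norm_mul, norm_mul]
      gcongr
      exact hut t ht
    have hsum : (∫ t in y..d, ‖z‖ * (N y * g t) * ‖ψ t‖)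
        + ∫ t in y..d, ‖z‖ * (N y * g t) * ‖φ t‖ = N y * ∫ t in y..d, h t := by
      rw [← intervalIntegral.integral_add (hbound ψ hψc) (hbound φ hφc),
        ← intervalIntegral.integral_const_mul]
      refine intervalIntegral.integral_congr fun t _ => ?_
      simp only [hh, hg]
      ring
    have hhd : ∫ t in y..d, h t ≤ ∫ t in 0..d, h t := by
      refine intervalIntegral.integral_mono_interval (hx.1.le.trans hy.1) hy.2 le_rfl
        (Filter.Eventually.of_forall hh0) (hhi.mono_set ?_)
      rw [uIcc_of_le hd0.le, uIcc_of_le hc.le]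
      exact Icc_subset_Icc_right hdc.le
    have hNy : N y ≤ N d + N y * (1 / 2) := by
      have := mul_le_mul_of_nonneg_left (hhd.trans hd.le) (hN0 y)
      calc N y = ‖A y‖ + ‖B y‖ := rfl
        _ ≤ (‖A d‖ + ‖B d‖) + N y * ∫ t in y..d, h t := by linarith
        _ ≤ N d + N y * (1 / 2) := by simp only [hN] at *; linarith
    have : N x ≤ N y := hmax (left_mem_Icc.2 hx.2.le)
    linarith
  refine ⟨d, ⟨hd0, hdc.le⟩, ?_⟩
  have hsub : Ioo 0 d ⊆ Ioo 0 c := Ioo_subset_Ioo_right hdc.le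
  refine ((hgi.mono_set hsub).const_mul ((2 * N d) ^ 2)).mono'
    ((huc.norm.pow 2).mono (hsub.trans hIooS) |>.aestronglyMeasurable measurableSet_Ioo)
    ((ae_restrict_iff' measurableSet_Ioo).2 (Filter.Eventually.of_forall fun t ht => ?_))
  rw [Real.norm_of_nonneg (by positivity), ← mul_pow]
  gcongr
  exact (huN t (hIooS (hsub ht))).trans (mul_le_mul_of_nonneg_right (hNd t ht) (hg0 t))

/-- Comparison with the solution `x ^ (-1/2)` of the equation with potential
`(3/4 - α/2) x ^ (α - 2)`. -/
lemma one_le_mul_rpow_half {S : Set ℝ} [OrdConnected S] (hS : IsOpen S) (hS0 : S ⊆ Ioi 0)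
    {α c x₁ : ℝ} {q u v : ℝ → ℝ} (hcS : Ioc 0 c ⊆ S) (hc : 0 < c) (hcx₁ : c < x₁)
    (hq : ∀ᵐ x : ℝ, x ∈ Ioo (0 : ℝ) x₁ → (3 / 4 - α / 2) * x ^ (α - 2) ≤ q x)
    (hu : PrimitiveOn S u fun t => t ^ (-α) * v t) (hv : PrimitiveOn S v fun t => q t * u t)
    (huc : u c = c ^ (-1 / 2 : ℝ)) (hvc : v c = -1 / 2 * c ^ (α - 3 / 2)) :
    ∀ x ∈ Ioc 0 c, 1 ≤ u x * x ^ (1 / 2 : ℝ) := by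
  have hcmem : c ∈ S := hcS ⟨hc, le_rfl⟩
  have hpow : ∀ s : ℝ, PrimitiveOn S (fun t => t ^ s) (fun t => s * t ^ (s - 1)) := fun s =>
    PrimitiveOn.of_hasDerivAt
      (fun t ht => Real.hasDerivAt_rpow_const (Or.inl (ne_of_gt (hS0 ht))))
      (fun t ht => (continuousAt_const.mul (Real.continuousAt_rpow_const _ _
        (Or.inl (ne_of_gt (hS0 ht))))).continuousWithinAt)
  set W : ℝ → ℝ := fun t => v t * t ^ (-1 / 2 : ℝ) + u t * (1 / 2 * t ^ (α - 3 / 2)) with hWdef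
  have hpowα : PrimitiveOn S (fun t => 1 / 2 * t ^ (α - 3 / 2))
      (fun t => 1 / 2 * ((α - 3 / 2) * t ^ (α - 3 / 2 - 1))) :=
    (hpow (α - 3 / 2)).clm_comp ((ContinuousLinearMap.mul ℝ ℝ) (1 / 2))
  have hW : PrimitiveOn S W
      (fun t => u t * t ^ (-1 / 2 : ℝ) * (q t - (3 / 4 - α / 2) * t ^ (α - 2))) := by
    refine ((hv.mul (hpow (-1 / 2))).add (hu.mul hpowα)).congr fun t ht => ?_
    have ht0 : 0 < t := hS0 ht
    have e1 : t ^ (-1 / 2 - 1 : ℝ) = t ^ (-α) * t ^ (α - 3 / 2) := by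
      rw [← Real.rpow_add ht0]; ring_nf
    have e2 : t ^ (α - 3 / 2 - 1) = t ^ (-1 / 2 : ℝ) * t ^ (α - 2) := by
      rw [← Real.rpow_add ht0]; ring_nf
    simp only [e1, e2]
    ring
  have hm : PrimitiveOn S (fun t => u t * t ^ (1 / 2 : ℝ)) (fun t => t ^ (1 - α) * W t) := by
    refine (hu.mul (hpow (1 / 2))).congr fun t ht => ?_
    have ht0 : 0 < t := hS0 ht
    have e1 : t ^ (1 / 2 : ℝ) = t * t ^ (-1 / 2 : ℝ) := by
      nth_rewrite 2 [← Real.rpow_one t]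
      rw [← Real.rpow_add ht0]; norm_num
    have e2 : t ^ (1 / 2 - 1 : ℝ) = t ^ (1 - α) * t ^ (α - 3 / 2) := by
      rw [← Real.rpow_add ht0]; ring_nf
    have e3 : t ^ (1 - α) = t * t ^ (-α) := by
      nth_rewrite 2 [← Real.rpow_one t]
      rw [← Real.rpow_add ht0]; ring_nf
    simp only [hWdef, e1, e2, e3]
    ring
  have hWc : W c = 0 := by
    have : c ^ (-1 / 2 : ℝ) * c ^ (α - 3 / 2) = c ^ (α - 3 / 2) * c ^ (-1 / 2 : ℝ) := mul_comm _ _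
    simp only [hWdef, huc, hvc]
    linarith
  have hmc : u c * c ^ (1 / 2 : ℝ) = 1 := by
    rw [huc, ← Real.rpow_add hc]; norm_num
  have hstep : ∀ x ∈ Ioc 0 c, (∀ t ∈ Ioc x c, 0 < u t) → 1 ≤ u x * x ^ (1 / 2 : ℝ) := by
    intro x hx hpos
    have hWneg : ∀ t ∈ Ioc x c, W t ≤ 0 := by
      intro t ht
      have h1 := (hW t (hcS ⟨hx.1.trans ht.1, ht.2⟩) c hcmem).2
      have h2 : 0 ≤ ∫ s in t..c, u s * s ^ (-1 / 2 : ℝ) * (q s - (3 / 4 - α / 2) * s ^ (α - 2)) := by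
        rw [intervalIntegral.integral_of_le ht.2]
        refine setIntegral_nonneg_ae measurableSet_Ioc ?_
        filter_upwards [hq] with s hs hst
        have hs0 : 0 < s := (hx.1.trans ht.1).trans hst.1
        have hus := hpos s ⟨ht.1.trans hst.1, hst.2⟩
        have := hs ⟨hs0, hst.2.trans_lt hcx₁⟩
        have : 0 ≤ q s - (3 / 4 - α / 2) * s ^ (α - 2) := by linarith
        positivity
      linarith
    have h1 := (hm x (hcS hx) c hcmem).2
    have h2 : ∫ s in x..c, s ^ (1 - α) * W s ≤ 0 := by
      rw [intervalIntegral.integral_of_le hx.2]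
      refine setIntegral_nonpos measurableSet_Ioc fun s hs => ?_
      exact mul_nonpos_of_nonneg_of_nonpos (Real.rpow_nonneg (hx.1.trans hs.1).le _) (hWneg s hs)
    simp only at h1
    linarith
  intro x hx
  refine hstep x hx ?_
  by_contra! hneg
  obtain ⟨t₀, ht₀, hut₀⟩ := hneg
  have hIcc : Icc x c ⊆ S := fun t ht => hcS ⟨hx.1.trans_le ht.1, ht.2⟩
  have hT : IsCompact (Icc x c ∩ u ⁻¹' Iic 0) :=
    isCompact_Icc.of_isClosed_subset
      (((hu.continuousOn hS).mono hIcc).preimage_isClosed_of_isClosed isClosed_Icc isClosed_Iic)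
      inter_subset_left
  obtain ⟨s, ⟨hs, hus⟩, hsmax⟩ := hT.exists_isGreatest ⟨t₀, Ioc_subset_Icc_self ht₀, hut₀⟩
  have hs0 : 0 < s := hx.1.trans_le hs.1
  have h1 := hstep s ⟨hs0, hs.2⟩ fun t ht => by
    by_contra! hut
    exact absurd (hsmax ⟨⟨hs.1.trans ht.1.le, ht.2⟩, hut⟩) (not_le.2 ht.1)
  have h2 : u s * s ^ (1 / 2 : ℝ) ≤ 0 :=
    mul_nonpos_of_nonpos_of_nonneg hus (Real.rpow_nonneg hs0.le _)
  linarith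

lemma isOpen_Iob (b : ℝ≥0∞) : IsOpen (Iob b) :=
  (isOpen_lt continuous_const continuous_id).inter
    (isOpen_lt ENNReal.continuous_ofReal continuous_const)

lemma ordConnected_Iob (b : ℝ≥0∞) : OrdConnected (Iob b) :=
  ⟨fun _ hx _ hy _ ht => ⟨hx.1.trans_le ht.1, (ENNReal.ofReal_le_ofReal ht.2).trans_lt hy.2⟩⟩

lemma PrimitiveOn.isSolutionC {b : ℝ≥0∞} {α : ℝ} {q : ℝ → ℝ} {z : ℂ} {u v : ℝ → ℂ}
    (hu : PrimitiveOn (Iob b) u fun t => ((t ^ (-α) : ℝ) : ℂ) * v t)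
    (hv : PrimitiveOn (Iob b) v fun t => ((q t : ℂ) - z) * u t) : IsSolutionC b α q z u v :=
  fun _ hx _ hx₀ => ⟨hu.eq_add hx₀ hx, hv.eq_add hx₀ hx⟩

lemma integrableOn_sq_norm_of_lintegral_ne_top {f : ℝ → ℂ} {s : Set ℝ} (hs : MeasurableSet s)
    (hf : ContinuousOn f s) (h : ∫⁻ x in s, (‖f x‖₊ : ℝ≥0∞) ^ 2 ≠ ⊤) :
    IntegrableOn (fun x => ‖f x‖ ^ 2) s := by
  refine ⟨(hf.norm.pow 2).aestronglyMeasurable hs, ?_⟩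
  rw [hasFiniteIntegral_iff_enorm]
  simpa [enorm_pow, enorm_eq_nnnorm] using h.lt_top

theorem statement0 (b : ℝ≥0∞) (hb : 0 < b) (α : ℝ) (q : ℝ → ℝ)
    (hq_meas : Measurable q) (hq_loc : LocallyIntegrableOn q (Iob b))
    (x₁ : ℝ) (hx₁ : x₁ ∈ Iob b)
    (hq : ∀ᵐ x : ℝ, x ∈ Ioo (0 : ℝ) x₁ → (3 / 4 - α / 2) * x ^ (α - 2) ≤ q x) :
    NonoscillatoryAtZero b α q ∧ LimitPointAtZero b α q := by
  have hS := isOpen_Iob b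
  have := ordConnected_Iob b
  have hS0 : Iob b ⊆ Ioi 0 := fun x hx => hx.1
  set c : ℝ := x₁ / 2 with hc_def
  have hx₁0 : 0 < x₁ := hx₁.1
  have hc : 0 < c := by positivity
  have hcx₁ : c < x₁ := by linarith
  have hIoc : Ioc 0 c ⊆ Iob b := fun t ht =>
    ⟨ht.1, (ENNReal.ofReal_le_ofReal (ht.2.trans hcx₁.le)).trans_lt hx₁.2⟩
  have hcS : c ∈ Iob b := hIoc ⟨hc, le_rfl⟩
  have hp : ∀ x ∈ Iob b, ∀ y ∈ Iob b,
      IntervalIntegrable (fun t : ℝ => ((t ^ (-α) : ℝ) : ℂ)) volume x y := by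
    intro x hx y hy
    refine ContinuousOn.intervalIntegrable fun t ht => ?_
    have ht0 : 0 < t := hS0 (OrdConnected.uIcc_subset ‹_› hx hy ht)
    exact (Complex.continuous_ofReal.continuousAt.comp
      (Real.continuousAt_rpow_const _ _ (Or.inl ht0.ne'))).continuousWithinAt
  have hqi : ∀ z : ℂ, ∀ x ∈ Iob b, ∀ y ∈ Iob b,
      IntervalIntegrable (fun t : ℝ => (q t : ℂ) - z) volume x y := by
    intro z x hx y hy
    have h1 : IntervalIntegrable q volume x y :=
      (hq_loc.integrableOn_compact_subset (OrdConnected.uIcc_subset ‹_› hx hy)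
        isCompact_uIcc).intervalIntegrable
    exact IntervalIntegrable.sub ⟨h1.1.ofReal, h1.2.ofReal⟩ intervalIntegrable_const
  obtain ⟨U, V, hUc, hVc, hU, hV⟩ := exists_primitiveOn_system hS hp (hqi 0) hcS
    ((c ^ (-1 / 2 : ℝ) : ℝ) : ℂ) ((-1 / 2 * c ^ (α - 3 / 2) : ℝ) : ℂ)
  set u : ℝ → ℝ := fun t => (U t).re with hu_def
  set v : ℝ → ℝ := fun t => (V t).re with hv_def
  have hu : PrimitiveOn (Iob b) u (fun t => t ^ (-α) * v t) := by
    simpa using hU.clm_comp Complex.reCLM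
  have hv : PrimitiveOn (Iob b) v (fun t => q t * u t) := by
    simpa using hV.clm_comp Complex.reCLM
  have hcmp := one_le_mul_rpow_half hS hS0 hIoc hc hcx₁ hq hu hv
    (by simp only [hu_def, hUc, Complex.ofReal_re]) (by simp only [hv_def, hVc, Complex.ofReal_re])
  have hne : ∀ x ∈ Ioc 0 c, u x ≠ 0 := by
    intro x hx h0
    have := hcmp x hx
    rw [h0, zero_mul] at this
    linarith
  refine ⟨⟨u, v, ?_, ?_, c, hcS, ?_⟩, fun z => ?_⟩
  · intro x hx x₀ hx₀
    simpa using And.intro (hu.eq_add hx₀ hx) (hv.eq_add hx₀ hx)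
  · exact fun h => hne c ⟨hc, le_rfl⟩ (h c hcS).1
  · convert Set.finite_empty
    ext x
    simpa using fun h1 h2 => hne x ⟨h1, h2.le⟩
  · by_contra! hcon
    obtain ⟨φ, φ', hφ0, hφ1, hφ, hφ'⟩ := exists_primitiveOn_system hS hp (hqi z) hcS 1 0
    obtain ⟨ψ, ψ', hψ0, hψ1, hψ, hψ'⟩ := exists_primitiveOn_system hS hp (hqi z) hcS 0 1
    have hsub : Ioo 0 c ⊆ Iob b := Ioo_subset_Ioc_self.trans hIoc
    obtain ⟨d, hd, hint⟩ := exists_integrableOn_sq_of_fundamental_system hS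
      (q := fun t => (q t : ℂ)) (u := fun t => (u t : ℂ)) (v := fun t => (v t : ℂ))
      (by simpa using hu.clm_comp Complex.ofRealCLM) (by simpa using hv.clm_comp Complex.ofRealCLM)
      hφ hφ' hψ hψ' hc hIoc (by rw [hφ0, hφ1, hψ0, hψ1]; norm_num)
      (integrableOn_sq_norm_of_lintegral_ne_top measurableSet_Ioo
        ((hφ.continuousOn hS).mono hsub) (hcon φ φ' (hφ.isSolutionC hφ') c hcS))
      (integrableOn_sq_norm_of_lintegral_ne_top measurableSet_Ioo
        ((hψ.continuousOn hS).mono hsub) (hcon ψ ψ' (hψ.isSolutionC hψ') c hcS))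
    have hinv : IntegrableOn (fun t : ℝ => t ^ (-1 : ℝ)) (Ioo 0 d) := by
      refine hint.mono' ?_ ((ae_restrict_iff' measurableSet_Ioo).2
        (Filter.Eventually.of_forall fun t ht => ?_))
      · exact (measurable_id.pow_const _).aestronglyMeasurable
      · have h1 := hcmp t ⟨ht.1, ht.2.le.trans hd.2⟩
        have h2 : (t ^ (1 / 2 : ℝ)) ^ 2 = t := by
          rw [← Real.rpow_natCast, ← Real.rpow_mul ht.1.le]; norm_num
        have h3 : 1 ≤ (u t) ^ 2 * t := by
          have := one_le_pow₀ h1 (n := 2)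
          rwa [mul_pow, h2] at this
        rw [Real.norm_of_nonneg (Real.rpow_nonneg ht.1.le _), Real.rpow_neg_one, Complex.norm_real,
          Real.norm_eq_abs, sq_abs, inv_le_iff_one_le_mul₀ ht.1]
        exact h3
    have := (intervalIntegral.integrableOn_Ioo_rpow_iff hd.1).1 hinv
    linarith
end
end

section
/- Let b ∈ (0,∞], α ∈ (−∞,2), and let q : (0,b) → ℝ be measurable and locally integrable. Suppose there exist N ∈ ℕ, ε > 0, and x₁ ∈ (0,b) such that the iterated logarithms ln₁(x),…,ln_N(x) are defined and positive on (0,x₁) and, for a.e. x ∈ (0,x₁), q(x) ≥ (3/4 − α/2)·x^(α−2) − (1/2)(2 − α)·x^(α−2)·Σ_{j=1}^{N} Π_{ℓ=1}^{j} [ln_ℓ(x)]^(−1) + (3/4 + ε)·x^(α−2)·[ln₁(x)]^(−2). Then τ_α = −(d/dx) x^α (d/dx) + q(x) is nonoscillatory at x = 0 and in the limit point case at x = 0. -/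
noncomputable section

open MeasureTheory Set
open scoped ENNReal NNReal

/-- `τ_α` is in the limit circle case at `x = 0`: for every `z ∈ ℂ` every solution
of `τ_α u = z u` is square-integrable near `0`. -/
def LimitCircleAtZero (b : ℝ≥0∞) (α : ℝ) (q : ℝ → ℝ) : Prop :=
  ∀ z : ℂ, ∀ u v : ℝ → ℂ, IsSolutionC b α q z u v →
    ∃ c ∈ Iob b, (∫⁻ x in Ioo (0 : ℝ) c, (‖u x‖₊ : ℝ≥0∞) ^ 2) < ⊤

/-- Iterated logarithms: `iterLog 1 x = ln (1/x)`, `iterLog (j+1) x = ln (iterLog j x)`. -/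
def iterLog : ℕ → ℝ → ℝ
  | 0, x => 1 / x
  | j + 1, x => Real.log (iterLog j x)

/-- `F` is absolutely continuous between `a` and `b` with almost everywhere derivative `f`. -/
structure HasACDeriv (F f : ℝ → ℝ) (a b : ℝ) : Prop where
  ac : AbsolutelyContinuousOnInterval F a b
  hasDerivAt : ∀ᵐ t, t ∈ uIcc a b → HasDerivAt F (f t) t

theorem AbsolutelyContinuousOnInterval.congr {F G : ℝ → ℝ} {a b : ℝ}
    (hF : AbsolutelyContinuousOnInterval F a b) (h : EqOn F G (uIcc a b)) :
    AbsolutelyContinuousOnInterval G a b := by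
  refine Filter.Tendsto.congr' ?_ hF
  filter_upwards [Filter.mem_inf_of_right (Filter.mem_principal_self _)] with E hE
  refine Finset.sum_congr rfl fun i hi => ?_
  rw [h (hE.1 i hi).1, h (hE.1 i hi).2]

namespace HasACDeriv

variable {F f G g : ℝ → ℝ} {a b : ℝ}

theorem integral_eq_sub (h : HasACDeriv F f a b) : ∫ t in a..b, f t = F b - F a := by
  rw [← h.ac.integral_deriv_eq_sub]
  refine intervalIntegral.integral_congr_ae ?_
  filter_upwards [h.hasDerivAt] with t ht hmem
  exact (ht (uIoc_subset_uIcc hmem)).deriv.symm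

theorem le_of_nonneg (h : HasACDeriv F f a b) (hab : a ≤ b)
    (hf : ∀ᵐ t, t ∈ Ioc a b → 0 ≤ f t) : F a ≤ F b := by
  have h0 : 0 ≤ ∫ t in a..b, f t := by
    rw [intervalIntegral.integral_of_le hab]
    exact setIntegral_nonneg_ae measurableSet_Ioc hf
  linarith [h.integral_eq_sub]

theorem add (hF : HasACDeriv F f a b) (hG : HasACDeriv G g a b) :
    HasACDeriv (fun t => F t + G t) (fun t => f t + g t) a b :=
  ⟨hF.ac.add hG.ac, by
    filter_upwards [hF.hasDerivAt, hG.hasDerivAt] with t h₁ h₂ ht using (h₁ ht).add (h₂ ht)⟩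

theorem sub (hF : HasACDeriv F f a b) (hG : HasACDeriv G g a b) :
    HasACDeriv (fun t => F t - G t) (fun t => f t - g t) a b :=
  ⟨hF.ac.sub hG.ac, by
    filter_upwards [hF.hasDerivAt, hG.hasDerivAt] with t h₁ h₂ ht using (h₁ ht).sub (h₂ ht)⟩

theorem mul (hF : HasACDeriv F f a b) (hG : HasACDeriv G g a b) :
    HasACDeriv (fun t => F t * G t) (fun t => f t * G t + F t * g t) a b :=
  ⟨hF.ac.mul hG.ac, by
    filter_upwards [hF.hasDerivAt, hG.hasDerivAt] with t h₁ h₂ ht using (h₁ ht).mul (h₂ ht)⟩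

theorem congr_left (hF : HasACDeriv F f a b) (h : EqOn F G (uIcc a b)) : HasACDeriv G f a b := by
  refine ⟨hF.ac.congr h, ?_⟩
  have ha : ∀ᵐ t : ℝ, t ≠ min a b := by simp [ae_iff, measure_singleton]
  have hb : ∀ᵐ t : ℝ, t ≠ max a b := by simp [ae_iff, measure_singleton]
  filter_upwards [hF.hasDerivAt, ha, hb] with t h₁ h₂ h₃ ht
  refine (h₁ ht).congr_of_eventuallyEq ?_
  filter_upwards [Icc_mem_nhds (lt_of_le_of_ne ht.1 h₂.symm) (lt_of_le_of_ne ht.2 h₃)] with s hs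
  exact (h hs).symm

theorem of_integral (hf : IntervalIntegrable f volume a b)
    (hF : ∀ x ∈ uIcc a b, F x = F a + ∫ t in a..x, f t) : HasACDeriv F f a b := by
  have hconst : AbsolutelyContinuousOnInterval (fun _ : ℝ => F a) a b :=
    contDiffOn_const.absolutelyContinuousOnInterval
  refine congr_left (F := fun x => F a + ∫ t in a..x, f t) ⟨hconst.add
    (hf.absolutelyContinuousOnInterval_intervalIntegral left_mem_uIcc), ?_⟩
    fun x hx => (hF x hx).symm
  filter_upwards [hf.ae_hasDerivAt_integral] with t ht hmem
  exact (ht hmem a left_mem_uIcc).const_add (F a)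

theorem of_contDiffOn (hF : ContDiffOn ℝ 1 F (uIcc a b))
    (hf : ∀ x ∈ uIcc a b, HasDerivAt F (f x) x) : HasACDeriv F f a b :=
  ⟨hF.absolutelyContinuousOnInterval, .of_forall hf⟩

end HasACDeriv

theorem integral_mul_primitive_pow {k : ℝ → ℝ} {a b : ℝ} (hk : IntervalIntegrable k volume a b)
    (n : ℕ) :
    ∫ t in a..b, k t * (∫ s in a..t, k s) ^ n = (∫ s in a..b, k s) ^ (n + 1) / (n + 1) := by
  have hK : HasACDeriv (fun x => ∫ s in a..x, k s) k a b :=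
    .of_integral hk fun x _ => by simp
  have hpow : ∀ n : ℕ, HasACDeriv (fun x => (∫ s in a..x, k s) ^ (n + 1))
      (fun t => (n + 1) * (k t * (∫ s in a..t, k s) ^ n)) a b := by
    intro n
    induction n with
    | zero => simpa using hK
    | succ n ih =>
      convert ih.mul hK using 2 <;> push_cast <;> ring
  have := (hpow n).integral_eq_sub
  rw [intervalIntegral.integral_const_mul] at this
  simp only [intervalIntegral.integral_same] at this
  rw [eq_div_iff (by positivity), mul_comm, this]
  simp

/-- Picard iterates for the linear system `u' = p v`, `v' = r u` with data `(u₀, v₀)` at `x₀`. -/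
def picardIterate {𝕜 : Type*} [RCLike 𝕜] (p r : ℝ → 𝕜) (x₀ : ℝ) (u₀ v₀ : 𝕜) :
    ℕ → (ℝ → 𝕜) × (ℝ → 𝕜)
  | 0 => (fun _ => u₀, fun _ => v₀)
  | n + 1 => (fun x => ∫ t in x₀..x, p t * (picardIterate p r x₀ u₀ v₀ n).2 t,
      fun x => ∫ t in x₀..x, r t * (picardIterate p r x₀ u₀ v₀ n).1 t)

theorem norm_integral_mul_le_pow_div_factorial {𝕜 : Type*} [RCLike 𝕜] {p w : ℝ → 𝕜} {k : ℝ → ℝ}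
    {x₀ x C : ℝ} {n : ℕ} (hC : 0 ≤ C) (hk : IntervalIntegrable k volume x₀ x)
    (hpk : ∀ t, ‖p t‖ ≤ k t)
    (hw : ∀ t ∈ uIcc x₀ x, ‖w t‖ ≤ C * (|∫ s in x₀..t, k s| ^ n / n.factorial)) :
    ‖∫ t in x₀..x, p t * w t‖ ≤ C * (|∫ s in x₀..x, k s| ^ (n + 1) / (n + 1).factorial) := by
  have hk0 : ∀ t, 0 ≤ k t := fun t => (norm_nonneg _).trans (hpk t)
  have hKc : ContinuousOn (fun t => ∫ s in x₀..t, k s) (uIcc x₀ x) :=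
    intervalIntegral.continuousOn_primitive_interval' hk left_mem_uIcc
  have hle : ‖∫ t in x₀..x, p t * w t‖ ≤
      |∫ t in x₀..x, k t * (C * (|∫ s in x₀..t, k s| ^ n / n.factorial))| := by
    refine intervalIntegral.norm_integral_le_abs_of_norm_le ?_
      (hk.mul_continuousOn (continuousOn_const.mul ((hKc.abs.pow n).div_const _)))
    refine (ae_restrict_mem measurableSet_uIoc).mono fun t ht => ?_
    rw [norm_mul]
    exact mul_le_mul (hpk t) (hw t (uIoc_subset_uIcc ht)) (norm_nonneg _) (hk0 t)
  have habs : |∫ t in x₀..x, k t * |∫ s in x₀..t, k s| ^ n| =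
      |∫ s in x₀..x, k s| ^ (n + 1) / (n + 1) := by
    have hpow := integral_mul_primitive_pow hk n
    rcases le_total x₀ x with h | h
    · have : ∫ t in x₀..x, k t * |∫ s in x₀..t, k s| ^ n =
          ∫ t in x₀..x, k t * (∫ s in x₀..t, k s) ^ n := by
        refine intervalIntegral.integral_congr fun t ht => ?_
        rw [uIcc_of_le h] at ht
        simp only [abs_of_nonneg (intervalIntegral.integral_nonneg ht.1 fun s _ => hk0 s)]
      rw [this, hpow, abs_div, abs_pow, abs_of_pos (by positivity : (0 : ℝ) < n + 1)]
    · have : ∫ t in x₀..x, k t * |∫ s in x₀..t, k s| ^ n =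
          (-1) ^ n * ∫ t in x₀..x, k t * (∫ s in x₀..t, k s) ^ n := by
        rw [← intervalIntegral.integral_const_mul]
        refine intervalIntegral.integral_congr fun t ht => ?_
        rw [uIcc_of_ge h] at ht
        have hneg : ∫ s in x₀..t, k s ≤ 0 := by
          rw [intervalIntegral.integral_symm]
          exact neg_nonpos.2 (intervalIntegral.integral_nonneg ht.2 fun s _ => hk0 s)
        simp only [abs_of_nonpos hneg, neg_pow (∫ s in x₀..t, k s) n]
        ring
      rw [this, hpow, abs_mul, abs_pow, abs_neg, abs_one, one_pow, one_mul, abs_div, abs_pow,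
        abs_of_pos (by positivity : (0 : ℝ) < n + 1)]
  have hpull : ∫ t in x₀..x, k t * (C * (|∫ s in x₀..t, k s| ^ n / n.factorial)) =
      C / n.factorial * ∫ t in x₀..x, k t * |∫ s in x₀..t, k s| ^ n := by
    rw [← intervalIntegral.integral_const_mul]
    congr 1 with t
    ring
  refine hle.trans ?_
  rw [hpull, abs_mul, habs, abs_of_nonneg (by positivity), Nat.factorial_succ]
  push_cast
  refine le_of_eq ?_
  field_simp

/-- Carathéodory existence for the linear system `u' = p v`, `v' = r u`. -/
theorem exists_linear_system_solution {𝕜 : Type*} [RCLike 𝕜] {S : Set ℝ} [S.OrdConnected]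
    {p r : ℝ → 𝕜} {x₀ : ℝ} (hx₀ : x₀ ∈ S)
    (hp : ∀ x ∈ S, ∀ y ∈ S, IntervalIntegrable p volume x y)
    (hr : ∀ x ∈ S, ∀ y ∈ S, IntervalIntegrable r volume x y) (u₀ v₀ : 𝕜) :
    ∃ u v : ℝ → 𝕜, u x₀ = u₀ ∧ v x₀ = v₀ ∧ ∀ x ∈ S, ∀ y ∈ S,
      IntervalIntegrable (fun t => p t * v t) volume x y ∧
      IntervalIntegrable (fun t => r t * u t) volume x y ∧
      (u x = u y + ∫ t in y..x, p t * v t) ∧ (v x = v y + ∫ t in y..x, r t * u t) := by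
  set k : ℝ → ℝ := fun t => ‖p t‖ + ‖r t‖
  set U : ℕ → (ℝ → 𝕜) × (ℝ → 𝕜) := picardIterate p r x₀ u₀ v₀
  set C : ℝ := ‖u₀‖ + ‖v₀‖
  have hk : ∀ x ∈ S, IntervalIntegrable k volume x₀ x := fun x hx =>
    (hp x₀ hx₀ x hx).norm.add (hr x₀ hx₀ x hx).norm
  have hpk : ∀ t, ‖p t‖ ≤ k t := fun t => le_add_of_nonneg_right (norm_nonneg _)
  have hrk : ∀ t, ‖r t‖ ≤ k t := fun t => le_add_of_nonneg_left (norm_nonneg _)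
  have hk0 : ∀ t, 0 ≤ k t := fun t => (norm_nonneg _).trans (hpk t)
  have hsub : ∀ x ∈ S, ∀ y ∈ S, uIcc x y ⊆ S := fun x hx y hy =>
    OrdConnected.uIcc_subset inferInstance hx hy
  have hcont : ∀ n, ∀ x ∈ S, ContinuousOn (U n).1 (uIcc x₀ x) ∧
      ContinuousOn (U n).2 (uIcc x₀ x) := by
    intro n
    induction n with
    | zero => exact fun x _ => ⟨continuousOn_const, continuousOn_const⟩
    | succ n ih =>
      refine fun x hx => ⟨?_, ?_⟩
      · exact intervalIntegral.continuousOn_primitive_interval'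
          ((hp x₀ hx₀ x hx).mul_continuousOn (ih x hx).2) left_mem_uIcc
      · exact intervalIntegral.continuousOn_primitive_interval'
          ((hr x₀ hx₀ x hx).mul_continuousOn (ih x hx).1) left_mem_uIcc
  have hC0 : 0 ≤ C := by positivity
  have hbound : ∀ n, ∀ x ∈ S,
      ‖(U n).1 x‖ ≤ C * (|∫ s in x₀..x, k s| ^ n / n.factorial) ∧
      ‖(U n).2 x‖ ≤ C * (|∫ s in x₀..x, k s| ^ n / n.factorial) := by
    intro n
    induction n with
    | zero =>
      intro x _
      simp only [U, C, picardIterate, pow_zero, Nat.factorial_zero, Nat.cast_one, div_one, mul_one]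
      exact ⟨le_add_of_nonneg_right (norm_nonneg _), le_add_of_nonneg_left (norm_nonneg _)⟩
    | succ n ih =>
      refine fun x hx => ⟨?_, ?_⟩
      · exact norm_integral_mul_le_pow_div_factorial hC0 (hk x hx) hpk
          fun t ht => (ih t (hsub _ hx₀ _ hx ht)).2
      · exact norm_integral_mul_le_pow_div_factorial hC0 (hk x hx) hrk
          fun t ht => (ih t (hsub _ hx₀ _ hx ht)).1
  have hmono : ∀ x ∈ S, ∀ t ∈ uIcc x₀ x, |∫ s in x₀..t, k s| ≤ |∫ s in x₀..x, k s| := by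
    intro x hx t ht
    refine intervalIntegral.abs_integral_mono_interval (uIoc_subset_uIoc_of_uIcc_subset_uIcc
      (uIcc_subset_uIcc left_mem_uIcc ht))
      (.of_forall hk0) (hk x hx)
  have hunif : ∀ n, ∀ x ∈ S, ∀ t ∈ uIcc x₀ x,
      ‖(U n).1 t‖ ≤ C * (|∫ s in x₀..x, k s| ^ n / n.factorial) ∧
      ‖(U n).2 t‖ ≤ C * (|∫ s in x₀..x, k s| ^ n / n.factorial) := by
    intro n x hx t ht
    have hle : C * (|∫ s in x₀..t, k s| ^ n / n.factorial) ≤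
        C * (|∫ s in x₀..x, k s| ^ n / n.factorial) := by
      gcongr ?_ * (?_ ^ _ / _)
      exact hmono x hx t ht
    exact ⟨((hbound n t (hsub _ hx₀ _ hx ht)).1).trans hle,
      ((hbound n t (hsub _ hx₀ _ hx ht)).2).trans hle⟩
  have hsum : ∀ x : ℝ, Summable fun n : ℕ => C * (|∫ s in x₀..x, k s| ^ n / n.factorial) :=
    fun x => (Real.summable_pow_div_factorial _).mul_left C
  have hseries : ∀ (a : ℝ → 𝕜) (W : ℕ → ℝ → 𝕜),
      (∀ x ∈ S, IntervalIntegrable a volume x₀ x) →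
      (∀ n, ∀ x ∈ S, ContinuousOn (W n) (uIcc x₀ x)) →
      (∀ n, ∀ x ∈ S, ∀ t ∈ uIcc x₀ x,
        ‖W n t‖ ≤ C * (|∫ s in x₀..x, k s| ^ n / n.factorial)) →
      ∀ x ∈ S, HasSum (fun n => ∫ t in x₀..x, a t * W n t) (∫ t in x₀..x, a t * ∑' n, W n t) := by
    intro a W ha hWc hWb x hx
    refine intervalIntegral.hasSum_integral_of_dominated_convergence
      (fun n t => ‖a t‖ * (C * (|∫ s in x₀..x, k s| ^ n / n.factorial))) ?_ ?_ ?_ ?_ ?_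
    · exact fun n => ((ha x hx).mul_continuousOn (hWc n x hx)).def'.aestronglyMeasurable
    · refine fun n => .of_forall fun t ht => ?_
      rw [norm_mul]
      gcongr
      exact hWb n x hx t (uIoc_subset_uIcc ht)
    · exact .of_forall fun t _ => (hsum x).mul_left _
    · simp only [tsum_mul_left]
      exact (ha x hx).norm.mul_const _
    · refine .of_forall fun t ht => HasSum.mul_left _ (Summable.hasSum ?_)
      exact .of_norm_bounded (hsum x) fun n => hWb n x hx t (uIoc_subset_uIcc ht)
  set u : ℝ → 𝕜 := fun x => ∑' n, (U n).1 x
  set v : ℝ → 𝕜 := fun x => ∑' n, (U n).2 x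
  have hu : ∀ x ∈ S, u x = u₀ + ∫ t in x₀..x, p t * v t := by
    intro x hx
    have hs : Summable fun n => (U n).1 x :=
      .of_norm_bounded (hsum x) fun n => (hbound n x hx).1
    simp only [u]
    rw [hs.tsum_eq_zero_add]
    congr 1
    exact (hseries p (fun n => (U n).2) (hp x₀ hx₀) (fun n x hx => (hcont n x hx).2)
      (fun n x hx t ht => (hunif n x hx t ht).2) x hx).tsum_eq
  have hv : ∀ x ∈ S, v x = v₀ + ∫ t in x₀..x, r t * u t := by
    intro x hx
    have hs : Summable fun n => (U n).2 x :=
      .of_norm_bounded (hsum x) fun n => (hbound n x hx).2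
    simp only [v]
    rw [hs.tsum_eq_zero_add]
    congr 1
    exact (hseries r (fun n => (U n).1) (hr x₀ hx₀) (fun n x hx => (hcont n x hx).1)
      (fun n x hx t ht => (hunif n x hx t ht).1) x hx).tsum_eq
  have hpv : ∀ x ∈ S, IntervalIntegrable (fun t => p t * v t) volume x₀ x := fun x hx =>
    (hp x₀ hx₀ x hx).mul_continuousOn (continuousOn_tsum (fun n => (hcont n x hx).2) (hsum x)
      fun n t ht => (hunif n x hx t ht).2)
  have hru : ∀ x ∈ S, IntervalIntegrable (fun t => r t * u t) volume x₀ x := fun x hx =>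
    (hr x₀ hx₀ x hx).mul_continuousOn (continuousOn_tsum (fun n => (hcont n x hx).1) (hsum x)
      fun n t ht => (hunif n x hx t ht).1)
  refine ⟨u, v, by simpa using hu x₀ hx₀, by simpa using hv x₀ hx₀, fun x hx y hy =>
    ⟨(hpv x hx).symm.trans (hpv y hy), (hru x hx).symm.trans (hru y hy), ?_, ?_⟩⟩
  · rw [hu x hx, hu y hy, add_assoc,
      intervalIntegral.integral_add_adjacent_intervals (hpv y hy) ((hpv y hy).symm.trans (hpv x hx))]
  · rw [hv x hx, hv y hy, add_assoc,
      intervalIntegral.integral_add_adjacent_intervals (hru y hy) ((hru y hy).symm.trans (hru x hx))]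

theorem HasACDeriv.le_of_nonpos {F f : ℝ → ℝ} {a b : ℝ} (h : HasACDeriv F f a b) (hab : a ≤ b)
    (hf : ∀ᵐ t, t ∈ Ioc a b → f t ≤ 0) : F b ≤ F a := by
  have h0 : ∫ t in a..b, f t ≤ 0 := by
    rw [intervalIntegral.integral_of_le hab]
    exact setIntegral_nonpos_ae measurableSet_Ioc hf
  linarith [h.integral_eq_sub]

theorem HasACDeriv.clm_comp {w h : ℝ → ℂ} {a b : ℝ} (L : ℂ →L[ℝ] ℝ)
    (hh : IntervalIntegrable h volume a b)
    (hw : ∀ x ∈ uIcc a b, w x = w a + ∫ t in a..x, h t) :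
    HasACDeriv (fun t => L (w t)) (fun t => L (h t)) a b := by
  refine .of_integral ⟨L.integrable_comp hh.1, L.integrable_comp hh.2⟩ fun x hx => ?_
  rw [L.intervalIntegral_comp_comm
    (hh.mono_set (uIcc_subset_uIcc left_mem_uIcc hx)), ← map_add, ← hw x hx]

/-- Comparison with a Riccati subsolution `ρ`: a solution which agrees with `ρ` at `d` satisfies
`|u|² g ≥ |u(d)|² g(d)` to the left of `d`, where `g' = -2 x^{-α} ρ g`. -/
theorem normSq_mul_le_normSq_mul {α d : ℝ} {q ρ ρ' g : ℝ → ℝ} {z : ℂ} {u v : ℝ → ℂ}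
    (huv : ∀ x ∈ Ioc 0 d, ∀ y ∈ Ioc 0 d,
      IntervalIntegrable (fun t => ((t ^ (-α) : ℝ) : ℂ) * v t) volume x y ∧
      IntervalIntegrable (fun t => ((q t : ℂ) - z) * u t) volume x y ∧
      (u x = u y + ∫ t in y..x, ((t ^ (-α) : ℝ) : ℂ) * v t) ∧
      (v x = v y + ∫ t in y..x, ((q t : ℂ) - z) * u t))
    (hρ : ContDiffOn ℝ 1 ρ (Ioc 0 d)) (hρ' : ∀ x ∈ Ioc 0 d, HasDerivAt ρ (ρ' x) x)
    (hg : ContDiffOn ℝ 1 g (Ioc 0 d))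
    (hg' : ∀ x ∈ Ioc 0 d, HasDerivAt g (-2 * x ^ (-α) * ρ x * g x) x)
    (hg0 : ∀ x ∈ Ioc 0 d, 0 < g x)
    (hq : ∀ᵐ x, x ∈ Ioc 0 d → ρ' x + x ^ (-α) * ρ x ^ 2 ≤ q x - z.re)
    (hd : v d = ρ d * u d) {x : ℝ} (hx : x ∈ Ioc 0 d) :
    Complex.normSq (u d) * g d ≤ Complex.normSq (u x) * g x := by
  have hdmem : d ∈ Ioc 0 d := ⟨hx.1.trans_le hx.2, le_rfl⟩
  have hsub : ∀ c ∈ Ioc 0 d, uIcc c d ⊆ Ioc 0 d := fun c hc =>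
    OrdConnected.uIcc_subset ordConnected_Ioc hc hdmem
  have hu : ∀ c ∈ Ioc 0 d, ∀ L : ℂ →L[ℝ] ℝ, HasACDeriv (fun t => L (u t))
      (fun t => L (((t ^ (-α) : ℝ) : ℂ) * v t)) c d := fun c hc L =>
    .clm_comp L (huv c hc d hdmem).1 fun t ht => (huv t (hsub c hc ht) c hc).2.2.1
  have hv : ∀ c ∈ Ioc 0 d, ∀ L : ℂ →L[ℝ] ℝ, HasACDeriv (fun t => L (v t))
      (fun t => L (((q t : ℂ) - z) * u t)) c d := fun c hc L =>
    .clm_comp L (huv c hc d hdmem).2.1 fun t ht => (huv t (hsub c hc ht) c hc).2.2.2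
  have hN : ∀ c ∈ Ioc 0 d, HasACDeriv (fun t => Complex.normSq (u t))
      (fun t => 2 * t ^ (-α) * ((v t).re * (u t).re + (v t).im * (u t).im)) c d := by
    intro c hc
    convert ((hu c hc Complex.reCLM).mul (hu c hc Complex.reCLM)).add
      ((hu c hc Complex.imCLM).mul (hu c hc Complex.imCLM)) using 2 with t t
    · exact Complex.normSq_apply _
    · simp only [Complex.reCLM_apply, Complex.imCLM_apply, Complex.re_ofReal_mul,
        Complex.im_ofReal_mul]
      ring
  set M : ℝ → ℝ := fun t =>
    (v t).re * (u t).re + (v t).im * (u t).im - ρ t * Complex.normSq (u t)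
  have hM : ∀ c ∈ Ioc 0 d, M c ≤ 0 := by
    intro c hc
    have hAC : HasACDeriv M _ c d :=
      (((hv c hc Complex.reCLM).mul (hu c hc Complex.reCLM)).add
        ((hv c hc Complex.imCLM).mul (hu c hc Complex.imCLM))).sub
        ((HasACDeriv.of_contDiffOn (hρ.mono (hsub c hc)) fun t ht => hρ' t (hsub c hc ht)).mul
          (hN c hc))
    have hMd : M d = 0 := by
      simp only [M, hd, Complex.re_ofReal_mul, Complex.im_ofReal_mul, Complex.normSq_apply]
      ring
    rw [← hMd]
    refine hAC.le_of_nonneg hc.2 ?_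
    filter_upwards [hq] with t ht htm
    have htd : t ∈ Ioc 0 d := ⟨hc.1.trans htm.1, htm.2⟩
    have hp : 0 ≤ t ^ (-α) := Real.rpow_nonneg htd.1.le _
    have h1 : 0 ≤ t ^ (-α) * (((v t).re - ρ t * (u t).re) ^ 2
        + ((v t).im - ρ t * (u t).im) ^ 2) := by positivity
    have h2 : 0 ≤ (q t - z.re - (ρ' t + t ^ (-α) * ρ t ^ 2)) * Complex.normSq (u t) :=
      mul_nonneg (sub_nonneg.2 (ht htd)) (Complex.normSq_nonneg _)
    simp only [Complex.reCLM_apply, Complex.imCLM_apply, Complex.mul_re, Complex.mul_im,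
      Complex.sub_re, Complex.sub_im, Complex.ofReal_re, Complex.ofReal_im, Complex.normSq_apply] at h2 ⊢
    linarith
  refine ((hN x hx).mul (HasACDeriv.of_contDiffOn (hg.mono (hsub x hx))
    fun t ht => hg' t (hsub x hx ht))).le_of_nonpos hx.2 (.of_forall fun t ht => ?_)
  have htd : t ∈ Ioc 0 d := ⟨hx.1.trans ht.1, ht.2⟩
  have h := mul_nonneg (mul_nonneg (Real.rpow_nonneg htd.1.le (-α)) (hg0 t htd).le)
    (neg_nonneg.2 (hM t htd))
  simp only [M] at h
  linarith

section

open Filter Topology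

theorem tendsto_iterLog (j : ℕ) : Tendsto (iterLog j) (𝓝[>] 0) atTop := by
  induction j with
  | zero => simpa [iterLog] using tendsto_inv_nhdsGT_zero (𝕜 := ℝ)
  | succ j ih => exact Real.tendsto_log_atTop.comp ih

theorem eventually_iterLog_pos (n : ℕ) :
    ∀ᶠ x in 𝓝[>] (0 : ℝ), 0 < x ∧ ∀ j ≤ n, 0 < iterLog j x :=
  (eventually_mem_nhdsWithin).and
    ((eventually_all_finite (finite_Iic n)).2 fun _ _ => (tendsto_iterLog _).eventually_gt_atTop 0)

/-- The product `∏_{l ≤ j} 1 / ln_l(x)`. -/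
def invLogProd (j : ℕ) (x : ℝ) : ℝ := ∏ l ∈ Finset.Icc 1 j, (iterLog l x)⁻¹

/-- The sum `∑_{j ≤ n} ∏_{l ≤ j} 1 / ln_l(x)`. -/
def invLogSum (n : ℕ) (x : ℝ) : ℝ := ∑ j ∈ Finset.Icc 1 n, invLogProd j x

@[simp] theorem invLogProd_zero (x : ℝ) : invLogProd 0 x = 1 := by simp [invLogProd]

@[simp] theorem invLogSum_zero (x : ℝ) : invLogSum 0 x = 0 := by simp [invLogSum]

theorem invLogProd_succ (j : ℕ) (x : ℝ) :
    invLogProd (j + 1) x = invLogProd j x * (iterLog (j + 1) x)⁻¹ :=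
  Finset.prod_Icc_succ_top (by omega) _

theorem invLogSum_succ (j : ℕ) (x : ℝ) :
    invLogSum (j + 1) x = invLogSum j x + invLogProd (j + 1) x :=
  Finset.sum_Icc_succ_top (by omega) _

section

variable {n : ℕ} {x : ℝ}

theorem invLogProd_pos (hx : ∀ j ≤ n, 0 < iterLog j x) : 0 < invLogProd n x :=
  Finset.prod_pos fun l hl => inv_pos.2 (hx l (Finset.mem_Icc.1 hl).2)

theorem hasDerivAt_iterLog (hx0 : 0 < x) (hx : ∀ j ≤ n, 0 < iterLog j x) :
    HasDerivAt (iterLog (n + 1)) (-(invLogProd n x / x)) x := by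
  induction n with
  | zero =>
    have h : iterLog (0 + 1) = fun y => -Real.log y := by
      ext y
      simp [iterLog]
    rw [h]
    simpa using (Real.hasDerivAt_log hx0.ne').fun_neg
  | succ n ih =>
    refine HasDerivAt.congr_deriv
      ((ih fun j hj => hx j (by omega)).log (hx (n + 1) le_rfl).ne') ?_
    rw [invLogProd_succ]
    ring

theorem contDiffAt_iterLog (hx0 : 0 < x) (hx : ∀ j ≤ n, 0 < iterLog j x) :
    ContDiffAt ℝ 1 (iterLog n) x := by
  induction n with
  | zero => exact contDiffAt_const.div contDiffAt_id hx0.ne'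
  | succ n ih => exact (ih fun j hj => hx j (by omega)).log (hx n (by omega)).ne'

theorem contDiffAt_invLogProd (hx0 : 0 < x) (hx : ∀ j ≤ n, 0 < iterLog j x) :
    ContDiffAt ℝ 1 (invLogProd n) x := by
  induction n with
  | zero =>
    rw [show invLogProd 0 = fun _ => 1 from funext invLogProd_zero]
    exact contDiffAt_const
  | succ n ih =>
    rw [show invLogProd (n + 1) = _ from funext (invLogProd_succ n)]
    exact (ih fun j hj => hx j (by omega)).mul
      ((contDiffAt_iterLog hx0 hx).inv (hx _ le_rfl).ne')

theorem contDiffAt_invLogSum (hx0 : 0 < x) (hx : ∀ j ≤ n, 0 < iterLog j x) :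
    ContDiffAt ℝ 1 (invLogSum n) x := by
  induction n with
  | zero =>
    rw [show invLogSum 0 = fun _ => 0 from funext invLogSum_zero]
    exact contDiffAt_const
  | succ n ih =>
    rw [show invLogSum (n + 1) = _ from funext (invLogSum_succ n)]
    exact (ih fun j hj => hx j (by omega)).add (contDiffAt_invLogProd hx0 hx)

theorem hasDerivAt_invLogProd (hx0 : 0 < x) (hx : ∀ j ≤ n, 0 < iterLog j x) :
    HasDerivAt (invLogProd n) (invLogProd n x * invLogSum n x / x) x := by
  induction n with
  | zero =>
    rw [show invLogProd 0 = fun _ => 1 from funext invLogProd_zero]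
    simpa using hasDerivAt_const x (1 : ℝ)
  | succ n ih =>
    have hx' : ∀ j ≤ n, 0 < iterLog j x := fun j hj => hx j (by omega)
    rw [show invLogProd (n + 1) = _ from funext (invLogProd_succ n)]
    refine ((ih hx').mul ((hasDerivAt_iterLog hx0 hx').fun_inv (hx _ le_rfl).ne')).congr_deriv ?_
    rw [invLogSum_succ, invLogProd_succ]
    have := (hx (n + 1) le_rfl).ne'
    field_simp

theorem hasDerivAt_invLogSum (hx0 : 0 < x) (hx : ∀ j ≤ n, 0 < iterLog j x) :
    HasDerivAt (invLogSum n)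
      ((∑ j ∈ Finset.Icc 1 n, invLogProd j x * invLogSum j x) / x) x := by
  rw [Finset.sum_div]
  exact HasDerivAt.fun_sum fun j hj => hasDerivAt_invLogProd hx0
    fun l hl => hx l (hl.trans (Finset.mem_Icc.1 hj).2)

theorem sum_invLogProd_mul_invLogSum_le (hx : ∀ j ≤ n, 0 < iterLog j x) :
    ∑ j ∈ Finset.Icc 1 n, invLogProd j x * invLogSum j x ≤ invLogSum n x ^ 2 := by
  have hpos : ∀ j ∈ Finset.Icc 1 n, 0 < invLogProd j x := fun j hj =>
    invLogProd_pos fun l hl => hx l (hl.trans (Finset.mem_Icc.1 hj).2)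
  rw [sq]
  conv_rhs => rw [invLogSum, Finset.sum_mul]
  refine Finset.sum_le_sum fun j hj => mul_le_mul_of_nonneg_left ?_ (hpos j hj).le
  refine Finset.sum_le_sum_of_subset_of_nonneg
    (Finset.Icc_subset_Icc_right (Finset.mem_Icc.1 hj).2) fun i hi _ => (hpos i hi).le

end

theorem tendsto_invLogProd_mul_iterLog_one (j : ℕ) :
    Tendsto (fun x => invLogProd (j + 2) x * iterLog 1 x) (𝓝[>] 0) (𝓝 0) := by
  induction j with
  | zero =>
    refine (tendsto_inv_atTop_zero.comp (tendsto_iterLog 2)).congr' ?_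
    filter_upwards [(tendsto_iterLog 1).eventually_gt_atTop 0] with x hx
    simp only [invLogProd_succ, invLogProd_zero, Function.comp_apply, zero_add, one_mul]
    field_simp
  | succ j ih =>
    have h := ih.mul (tendsto_inv_atTop_zero.comp (tendsto_iterLog (j + 3)))
    rw [zero_mul] at h
    refine h.congr fun x => ?_
    rw [invLogProd_succ (j + 2)]
    simp only [Function.comp_apply]
    ring

theorem tendsto_invLogSum_mul_iterLog_one (n : ℕ) :
    Tendsto (fun x => invLogSum (n + 1) x * iterLog 1 x) (𝓝[>] 0) (𝓝 1) := by
  induction n with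
  | zero =>
    refine tendsto_const_nhds.congr' ?_
    filter_upwards [(tendsto_iterLog 1).eventually_gt_atTop 0] with x hx
    simp only [invLogSum_succ, invLogProd_succ, invLogProd_zero, invLogSum_zero, zero_add, one_mul]
    field_simp
  | succ n ih =>
    have h := ih.add (tendsto_invLogProd_mul_iterLog_one n)
    rw [add_zero] at h
    refine h.congr fun x => ?_
    rw [invLogSum_succ (n + 1)]
    ring

theorem tendsto_rpow_mul_iterLog_one_sq {r : ℝ} (hr : 0 < r) :
    Tendsto (fun x => x ^ r * iterLog 1 x ^ 2) (𝓝[>] 0) (𝓝 0) := by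
  have h := (tendsto_log_mul_rpow_nhdsGT_zero (half_pos hr)).pow 2
  rw [zero_pow two_ne_zero] at h
  refine h.congr' ?_
  filter_upwards [eventually_mem_nhdsWithin] with x hx
  have hx0 : (0 : ℝ) < x := hx
  rw [mul_pow, ← Real.rpow_natCast (x ^ (r / 2)) 2, ← Real.rpow_mul hx0.le]
  simp only [iterLog, one_div, Real.log_inv, Nat.cast_ofNat, div_mul_cancel₀ r two_ne_zero]
  ring

theorem not_integrableOn_invLogProd_div (n : ℕ) {d : ℝ} (hd : 0 < d) :
    ¬ IntegrableOn (fun x => invLogProd n x / x) (Ioo 0 d) := by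
  have hder : ∀ᶠ x in 𝓝[>] (0 : ℝ),
      HasDerivAt (iterLog (n + 1)) (-(invLogProd n x / x)) x :=
    (eventually_iterLog_pos n).mono fun x hx => hasDerivAt_iterLog hx.1 hx.2
  refine not_integrableOn_of_tendsto_norm_atTop_of_deriv_isBigO_filter (f := iterLog (n + 1))
    (𝓝[>] 0) (Ioo_mem_nhdsGT hd) (hder.mono fun x hx => hx.differentiableAt)
    (tendsto_norm_atTop_atTop.comp (tendsto_iterLog _)) ?_
  refine Asymptotics.IsBigO.of_bound 1 (hder.mono fun x hx => ?_)
  rw [hx.deriv, norm_neg, one_mul]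

/-- Logarithmic quasi-derivative `x^α f' / f` of `f = x^{-1/2} ∏_{j ≤ n} ln_j(x)^{-1/2}`. -/
def logRiccati (α : ℝ) (n : ℕ) (x : ℝ) : ℝ := x ^ (α - 1) * ((invLogSum n x - 1) / 2)

section

variable {α : ℝ} {n : ℕ} {x : ℝ}

theorem contDiffAt_logRiccati (hx0 : 0 < x) (hx : ∀ j ≤ n, 0 < iterLog j x) :
    ContDiffAt ℝ 1 (logRiccati α n) x :=
  (Real.contDiffAt_rpow_const_of_ne hx0.ne').mul
    (((contDiffAt_invLogSum hx0 hx).sub contDiffAt_const).div_const 2)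

theorem hasDerivAt_logRiccati (hx0 : 0 < x) (hx : ∀ j ≤ n, 0 < iterLog j x) :
    HasDerivAt (logRiccati α n)
      (x ^ (α - 2) * ((α - 1) * (invLogSum n x - 1) / 2
        + (∑ j ∈ Finset.Icc 1 n, invLogProd j x * invLogSum j x) / 2)) x := by
  refine ((Real.hasDerivAt_rpow_const (p := α - 1) (.inl hx0.ne')).mul
    (((hasDerivAt_invLogSum hx0 hx).sub_const 1).div_const 2)).congr_deriv ?_
  have h1 : x ^ (α - 1) = x ^ (α - 2) * x := by
    rw [← Real.rpow_add_one hx0.ne']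
    ring_nf
  rw [show α - 1 - 1 = α - 2 by ring, h1]
  field_simp

theorem rpow_neg_mul_logRiccati (hx0 : 0 < x) :
    x ^ (-α) * logRiccati α n x = (invLogSum n x - 1) / 2 / x := by
  rw [logRiccati, ← mul_assoc, ← Real.rpow_add hx0, show -α + (α - 1) = -1 by ring,
    Real.rpow_neg_one]
  ring

theorem rpow_neg_mul_logRiccati_sq (hx0 : 0 < x) :
    x ^ (-α) * logRiccati α n x ^ 2 = x ^ (α - 2) * ((invLogSum n x - 1) ^ 2 / 4) := by
  rw [sq, ← mul_assoc, rpow_neg_mul_logRiccati hx0, logRiccati, Real.rpow_sub_one hx0.ne' α,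
    Real.rpow_sub hx0, Real.rpow_two]
  field_simp
  ring

theorem hasDerivAt_div_invLogProd (hx0 : 0 < x) (hx : ∀ j ≤ n, 0 < iterLog j x) :
    HasDerivAt (fun y => y / invLogProd n y)
      (-2 * x ^ (-α) * logRiccati α n x * (x / invLogProd n x)) x := by
  have hP := (invLogProd_pos hx).ne'
  refine ((hasDerivAt_id x).fun_div (hasDerivAt_invLogProd hx0 hx) hP).congr_deriv ?_
  rw [mul_assoc (-2 : ℝ), rpow_neg_mul_logRiccati hx0]
  simp only [id_eq]
  field_simp
  ring

end

theorem eventually_remainder_le {α ε : ℝ} (hα : α < 2) (hε : 0 < ε) (n : ℕ) (lam : ℝ) :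
    ∀ᶠ x in 𝓝[>] (0 : ℝ), 3 / 4 * x ^ (α - 2) * invLogSum (n + 1) x ^ 2 + lam ≤
      (3 / 4 + ε) * x ^ (α - 2) * (iterLog 1 x)⁻¹ ^ 2 := by
  have h1 := ((tendsto_invLogSum_mul_iterLog_one n).pow 2).const_mul (3 / 4 : ℝ)
  have h2 := (tendsto_rpow_mul_iterLog_one_sq (sub_pos.2 hα)).const_mul lam
  have h3 := h1.add h2
  have hlt : 3 / 4 * (1 : ℝ) ^ 2 + lam * 0 < 3 / 4 + ε := by linarith
  filter_upwards [h3.eventually_lt_const hlt,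
    eventually_iterLog_pos 1] with x hx hpos
  have hL : 0 < iterLog 1 x := hpos.2 1 le_rfl
  have hpow : x ^ (α - 2) * x ^ (2 - α) = 1 := by
    rw [← Real.rpow_add hpos.1]
    simp
  have hp : 0 < x ^ (α - 2) * (iterLog 1 x)⁻¹ ^ 2 := by
    have := Real.rpow_pos_of_pos hpos.1 (α - 2)
    positivity
  have := mul_le_mul_of_nonneg_left hx.le hp.le
  have hLL : (iterLog 1 x)⁻¹ * iterLog 1 x = 1 := inv_mul_cancel₀ hL.ne'
  calc _ = x ^ (α - 2) * (iterLog 1 x)⁻¹ ^ 2 * (3 / 4 * (invLogSum (n + 1) x * iterLog 1 x) ^ 2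
        + lam * (x ^ (2 - α) * iterLog 1 x ^ 2)) := by
        linear_combination (-(3 / 4) * x ^ (α - 2) * invLogSum (n + 1) x ^ 2
          - lam * (x ^ (α - 2) * x ^ (2 - α))) * ((iterLog 1 x)⁻¹ * iterLog 1 x + 1) * hLL
          - lam * hpow
    _ ≤ _ := this
    _ = _ := by ring

theorem exists_logRiccati_comparison {α ε x₁ : ℝ} {q : ℝ → ℝ} (hα : α < 2) {N : ℕ} (hN : 1 ≤ N)
    (hε : 0 < ε) (hx₁ : 0 < x₁)
    (hq : ∀ᵐ x : ℝ, x ∈ Ioo (0 : ℝ) x₁ →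
      (3 / 4 - α / 2) * x ^ (α - 2)
        - (1 / 2) * (2 - α) * x ^ (α - 2) * invLogSum N x
        + (3 / 4 + ε) * x ^ (α - 2) * ((iterLog 1 x)⁻¹) ^ 2 ≤ q x) (z : ℂ) :
    ∃ d ∈ Ioo 0 x₁, (∀ x ∈ Ioc 0 d, 0 < x / invLogProd N x) ∧ ∀ u v : ℝ → ℂ,
      (∀ x ∈ Ioc 0 d, ∀ y ∈ Ioc 0 d,
        IntervalIntegrable (fun t => ((t ^ (-α) : ℝ) : ℂ) * v t) volume x y ∧
        IntervalIntegrable (fun t => ((q t : ℂ) - z) * u t) volume x y ∧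
        (u x = u y + ∫ t in y..x, ((t ^ (-α) : ℝ) : ℂ) * v t) ∧
        (v x = v y + ∫ t in y..x, ((q t : ℂ) - z) * u t)) →
      v d = logRiccati α N d * u d → ∀ x ∈ Ioc 0 d,
        Complex.normSq (u d) * (d / invLogProd N d) ≤
          Complex.normSq (u x) * (x / invLogProd N x) := by
  obtain ⟨n, rfl⟩ := Nat.exists_eq_add_of_le' hN
  have hev := (eventually_remainder_le hα hε n z.re).and (eventually_iterLog_pos (n + 1))
  obtain ⟨d₀, hd₀, hd₀'⟩ := mem_nhdsGT_iff_exists_Ioc_subset.1 hev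
  have hd₀0 : (0 : ℝ) < d₀ := hd₀
  set d := min d₀ (x₁ / 2)
  have hd : 0 < d := lt_min hd₀0 (half_pos hx₁)
  have hdx : d < x₁ := (min_le_right _ _).trans_lt (half_lt_self hx₁)
  have hall : ∀ x ∈ Ioc 0 d, _ := fun x hx => hd₀' ⟨hx.1, hx.2.trans (min_le_left _ _)⟩
  have hg0 : ∀ x ∈ Ioc 0 d, 0 < x / invLogProd (n + 1) x := fun x hx =>
    div_pos hx.1 (invLogProd_pos (hall x hx).2.2)
  refine ⟨d, ⟨hd, hdx⟩, hg0, fun u v huv hdv x hx => ?_⟩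
  refine normSq_mul_le_normSq_mul (ρ := logRiccati α (n + 1))
    (g := fun x => x / invLogProd (n + 1) x) huv
    (fun x hx => (contDiffAt_logRiccati hx.1 (hall x hx).2.2).contDiffWithinAt)
    (fun x hx => hasDerivAt_logRiccati hx.1 (hall x hx).2.2)
    (fun x hx => (contDiffAt_id.div (contDiffAt_invLogProd hx.1 (hall x hx).2.2)
      (invLogProd_pos (hall x hx).2.2).ne').contDiffWithinAt)
    (fun x hx => hasDerivAt_div_invLogProd hx.1 (hall x hx).2.2) hg0 ?_ hdv hx
  filter_upwards [hq] with t ht htd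
  have h1 := ht ⟨htd.1, htd.2.trans_lt hdx⟩
  have h2 : _ ≤ _ := (hall t htd).1
  have h3 := mul_le_mul_of_nonneg_left (sum_invLogProd_mul_invLogSum_le (hall t htd).2.2)
    (Real.rpow_pos_of_pos htd.1 (α - 2)).le
  rw [rpow_neg_mul_logRiccati_sq htd.1]
  linarith

theorem Iob_ordConnected (b : ℝ≥0∞) : (Iob b).OrdConnected :=
  ⟨fun _ hx _ hy _ hz => ⟨hx.1.trans_le hz.1, (ENNReal.ofReal_le_ofReal hz.2).trans_lt hy.2⟩⟩

theorem Ioc_subset_Iob {b : ℝ≥0∞} {d : ℝ} (hd : d ∈ Iob b) : Ioc 0 d ⊆ Iob b := fun _ hx =>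
  ⟨hx.1, (ENNReal.ofReal_le_ofReal hx.2).trans_lt hd.2⟩

theorem intervalIntegrable_rpow_of_mem_Iob {b : ℝ≥0∞} (p : ℝ) {x y : ℝ} (hx : x ∈ Iob b)
    (hy : y ∈ Iob b) : IntervalIntegrable (fun t : ℝ => t ^ p) volume x y :=
  intervalIntegral.intervalIntegrable_rpow
    (.inr fun h => lt_irrefl _ ((Iob_ordConnected b).uIcc_subset hx hy h).1)

theorem intervalIntegrable_of_mem_Iob {b : ℝ≥0∞} {q : ℝ → ℝ} (hq : LocallyIntegrableOn q (Iob b))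
    {x y : ℝ} (hx : x ∈ Iob b) (hy : y ∈ Iob b) : IntervalIntegrable q volume x y :=
  (hq.integrableOn_compact_subset ((Iob_ordConnected b).uIcc_subset hx hy)
    isCompact_uIcc).intervalIntegrable

theorem measurable_iterLog (j : ℕ) : Measurable (iterLog j) := by
  induction j with
  | zero => exact measurable_const.div measurable_id
  | succ j ih => exact Real.measurable_log.comp ih

theorem measurable_invLogProd (n : ℕ) : Measurable (invLogProd n) :=
  Finset.measurable_fun_prod _ fun l _ => (measurable_iterLog l).inv

theorem lintegral_nnnorm_sq_eq_top {n : ℕ} {d A : ℝ} {u : ℝ → ℂ} (hd : 0 < d) (hA : 0 < A)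
    (hpos : ∀ x ∈ Ioc 0 d, 0 < x / invLogProd n x)
    (h : ∀ x ∈ Ioc 0 d, A ≤ Complex.normSq (u x) * (x / invLogProd n x)) :
    (∫⁻ x in Ioo (0 : ℝ) d, (‖u x‖₊ : ℝ≥0∞) ^ 2) = ⊤ := by
  by_contra hfin
  refine not_integrableOn_invLogProd_div n hd
    ⟨((measurable_invLogProd n).div measurable_id).aestronglyMeasurable, ?_⟩
  calc ∫⁻ x in Ioo 0 d, ‖invLogProd n x / x‖ₑ
      ≤ ∫⁻ x in Ioo 0 d, ENNReal.ofReal A⁻¹ * (‖u x‖₊ : ℝ≥0∞) ^ 2 := by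
        refine setLIntegral_mono' measurableSet_Ioo fun x hx => ?_
        have hx' : x ∈ Ioc 0 d := Ioo_subset_Ioc_self hx
        have hp : 0 < invLogProd n x / x := by
          rw [← inv_div]
          exact inv_pos.2 (hpos x hx')
        have hle : invLogProd n x / x ≤ A⁻¹ * ‖u x‖ ^ 2 := by
          have h1 := h x hx'
          rw [← inv_div, ← div_eq_mul_inv, le_div_iff₀ hp, Complex.normSq_eq_norm_sq] at h1
          rwa [inv_mul_eq_div, le_div_iff₀ hA, mul_comm]
        rw [Real.enorm_eq_ofReal hp.le]
        refine (ENNReal.ofReal_le_ofReal hle).trans_eq ?_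
        rw [ENNReal.ofReal_mul (inv_pos.2 hA).le, ENNReal.ofReal_pow (norm_nonneg _),
          ofReal_norm, enorm_eq_nnnorm]
    _ = ENNReal.ofReal A⁻¹ * ∫⁻ x in Ioo 0 d, (‖u x‖₊ : ℝ≥0∞) ^ 2 :=
        lintegral_const_mul' _ _ ENNReal.ofReal_ne_top
    _ < ⊤ := ENNReal.mul_lt_top ENNReal.ofReal_lt_top (Ne.lt_top hfin)

end

theorem statement1 (b : ℝ≥0∞) (hb : 0 < b) (α : ℝ) (hα : α < 2) (q : ℝ → ℝ)
    (hq_meas : Measurable q) (hq_loc : LocallyIntegrableOn q (Iob b))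
    (N : ℕ) (hN : 1 ≤ N) (ε : ℝ) (hε : 0 < ε)
    (x₁ : ℝ) (hx₁ : x₁ ∈ Iob b)
    (hpos : ∀ x ∈ Ioo (0 : ℝ) x₁, ∀ j ∈ Finset.Icc 1 N, 0 < iterLog j x)
    (hq : ∀ᵐ x : ℝ, x ∈ Ioo (0 : ℝ) x₁ →
      (3 / 4 - α / 2) * x ^ (α - 2)
        - (1 / 2) * (2 - α) * x ^ (α - 2) *
            ∑ j ∈ Finset.Icc 1 N, ∏ l ∈ Finset.Icc 1 j, (iterLog l x)⁻¹
        + (3 / 4 + ε) * x ^ (α - 2) * ((iterLog 1 x)⁻¹) ^ 2 ≤ q x) :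
    NonoscillatoryAtZero b α q ∧ LimitPointAtZero b α q := by
  have hIob := Iob_ordConnected b
  have hp := fun x (hx : x ∈ Iob b) y (hy : y ∈ Iob b) =>
    intervalIntegrable_rpow_of_mem_Iob (-α) hx hy
  have hqi := fun x (hx : x ∈ Iob b) y (hy : y ∈ Iob b) =>
    intervalIntegrable_of_mem_Iob hq_loc hx hy
  have hcomp := exists_logRiccati_comparison hα hN hε hx₁.1 hq
  constructor
  · obtain ⟨d, hd, hg, hcmp⟩ := hcomp 0
    have hdb : d ∈ Iob b := Ioc_subset_Iob hx₁ (Ioo_subset_Ioc_self hd)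
    obtain ⟨u, v, hud, hvd, huv⟩ := exists_linear_system_solution (𝕜 := ℝ) (r := fun t => q t - 0)
      hdb hp (fun x hx y hy => (hqi x hx y hy).sub intervalIntegrable_const) 1 (logRiccati α N d)
    refine ⟨u, v, fun x hx y hy => (huv x hx y hy).2.2, fun h => one_ne_zero (hud ▸ (h d hdb).1),
      d, hdb, ?_⟩
    have hne : ∀ x ∈ Ioc 0 d, u x ≠ 0 := by
      intro x hx hux
      have h := hcmp (fun t => (u t : ℂ)) (fun t => (v t : ℂ)) ?_ ?_ x hx
      · simp only [hud, hux, Complex.ofReal_zero, Complex.ofReal_one, map_zero, map_one, one_mul,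
          zero_mul] at h
        exact h.not_gt (hg d ⟨hd.1, le_rfl⟩)
      · intro x hx y hy
        obtain ⟨h1, h2, h3, h4⟩ :=
          huv x (Ioc_subset_Iob hdb hx) y (Ioc_subset_Iob hdb hy)
        simp only [sub_zero] at h2 h4 ⊢
        simp only [← Complex.ofReal_mul, intervalIntegral.integral_ofReal, ← Complex.ofReal_add]
        exact ⟨⟨h1.1.ofReal, h1.2.ofReal⟩, ⟨h2.1.ofReal, h2.2.ofReal⟩, congrArg _ h3,
          congrArg _ h4⟩
      · simp [hud, hvd]
    convert Set.finite_empty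
    exact Set.eq_empty_of_forall_notMem fun x hx => hne x (Ioo_subset_Ioc_self hx.1) hx.2
  · intro z
    obtain ⟨d, hd, hg, hcmp⟩ := hcomp z
    have hdb : d ∈ Iob b := Ioc_subset_Iob hx₁ (Ioo_subset_Ioc_self hd)
    obtain ⟨u, v, hud, hvd, huv⟩ := exists_linear_system_solution (𝕜 := ℂ)
      (p := fun t => ((t ^ (-α) : ℝ) : ℂ)) (r := fun t => (q t : ℂ) - z) hdb
      (fun x hx y hy => ⟨(hp x hx y hy).1.ofReal, (hp x hx y hy).2.ofReal⟩)
      (fun x hx y hy => IntervalIntegrable.sub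
        ⟨(hqi x hx y hy).1.ofReal, (hqi x hx y hy).2.ofReal⟩ intervalIntegrable_const)
      1 (logRiccati α N d : ℂ)
    refine ⟨u, v, fun x hx y hy => (huv x hx y hy).2.2, d, hdb,
      lintegral_nnnorm_sq_eq_top hd.1 (hg d ⟨hd.1, le_rfl⟩) hg fun x hx => ?_⟩
    have h := hcmp u v (fun x hx y hy => huv x (Ioc_subset_Iob hdb hx) y (Ioc_subset_Iob hdb hy))
      (by rw [hud, hvd, mul_one]) x hx
    rwa [hud, map_one, one_mul] at h
end
end

section
/- (Kurss-type comparison, limit point case.) Assume p, q₁, q₂, r satisfy Hypothesis 2.1 on (a,b) ⊆ ℝ, and let τ_j = r(x)^(−1)[−(d/dx) p(x)(d/dx) + q_j(x)], j = 1,2. If τ₁ is nonoscillatory at a and in the limit point case at a, and q₂ ≥ q₁ a.e. on (a,b), then τ₂ is nonoscillatory at a and in the limit point case at a. -/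
noncomputable section

open MeasureTheory Set
open scoped ENNReal NNReal

/-- The open interval `(a, b) ⊆ ℝ` with extended-real endpoints. -/
def IabE (a b : EReal) : Set ℝ := {x : ℝ | a < (x : EReal) ∧ (x : EReal) < b}

/-- Hypothesis 2.1 for the Sturm–Liouville expression
`τ = r(x)⁻¹ [-(d/dx) p(x) (d/dx) + q(x)]` on `(a, b)`. -/
structure Hyp21 (a b : EReal) (p q r : ℝ → ℝ) : Prop where
  hab : a < b
  p_meas : Measurable p
  q_meas : Measurable q
  r_meas : Measurable r
  r_pos : ∀ᵐ x : ℝ, x ∈ IabE a b → 0 < r x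
  r_loc : LocallyIntegrableOn r (IabE a b)
  p_pos : ∀ᵐ x : ℝ, x ∈ IabE a b → 0 < p x
  invp_loc : LocallyIntegrableOn (fun x => 1 / p x) (IabE a b)
  q_loc : LocallyIntegrableOn q (IabE a b)

/-- `(u, v)` is a real-valued solution of `τ u = λ u` on `(a, b)`, where
`τ = r(x)⁻¹ [-(d/dx) p(x) (d/dx) + q(x)]` and `v` plays the role of the
quasi-derivative `u^[1] = p u'`. -/
def IsSolution3R (a b : EReal) (p q r : ℝ → ℝ) (lam : ℝ) (u v : ℝ → ℝ) : Prop :=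
  ∀ x ∈ IabE a b, ∀ x₀ ∈ IabE a b,
    (u x = u x₀ + ∫ t in x₀..x, v t / p t) ∧
    (v x = v x₀ + ∫ t in x₀..x, (q t - lam * r t) * u t)

/-- `(u, v)` is a complex-valued solution of `τ u = z u` on `(a, b)`. -/
def IsSolution3C (a b : EReal) (p q r : ℝ → ℝ) (z : ℂ) (u v : ℝ → ℂ) : Prop :=
  ∀ x ∈ IabE a b, ∀ x₀ ∈ IabE a b,
    (u x = u x₀ + ∫ t in x₀..x, v t / (p t : ℂ)) ∧
    (v x = v x₀ + ∫ t in x₀..x, ((q t : ℂ) - z * (r t : ℂ)) * u t)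

/-- `τ` is in the limit point case at `a`: for every `z ∈ ℂ` there is a solution of
`τ u = z u` with `∫_a^c |u|² r dx = ∞` for some `c ∈ (a, b)`. -/
def LimitPointAtA (a b : EReal) (p q r : ℝ → ℝ) : Prop :=
  ∀ z : ℂ, ∃ u v : ℝ → ℂ, IsSolution3C a b p q r z u v ∧
    ∃ c : ℝ, c ∈ IabE a b ∧
      (∫⁻ x in IabE a (c : EReal),
        (‖u x‖₊ : ℝ≥0∞) ^ 2 * ENNReal.ofReal (r x)) = ⊤

/-- `τ` is in the limit circle case at `a`: for every `z ∈ ℂ` every solution of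
`τ u = z u` satisfies `∫_a^c |u|² r dx < ∞` for some `c ∈ (a, b)`. -/
def LimitCircleAtA (a b : EReal) (p q r : ℝ → ℝ) : Prop :=
  ∀ z : ℂ, ∀ u v : ℝ → ℂ, IsSolution3C a b p q r z u v →
    ∃ c : ℝ, c ∈ IabE a b ∧
      (∫⁻ x in IabE a (c : EReal),
        (‖u x‖₊ : ℝ≥0∞) ^ 2 * ENNReal.ofReal (r x)) < ⊤

/-- `τ` is nonoscillatory at `a`: some nontrivial real-valued solution of `τ u = 0`
has finitely many zeros in `(a, c)` for some `c ∈ (a, b)`. -/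
def NonoscillatoryAtA (a b : EReal) (p q r : ℝ → ℝ) : Prop :=
  ∃ u v : ℝ → ℝ, IsSolution3R a b p q r 0 u v ∧
    (¬ ∀ x ∈ IabE a b, u x = 0 ∧ v x = 0) ∧
    ∃ c : ℝ, c ∈ IabE a b ∧ {x ∈ IabE a (c : EReal) | u x = 0}.Finite

open Filter Topology

/-! ### Primitives of locally integrable functions -/

section Primitive

variable {E : Type*} [NormedAddCommGroup E] [NormedSpace ℝ E]

/-- `F` is a primitive of `f` on `I`: `f` is integrable between any two points of `I`, and the
integral is the increment of `F`. -/
def IsPrimitiveOn (I : Set ℝ) (F f : ℝ → E) : Prop :=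
  ∀ x ∈ I, ∀ y ∈ I, IntervalIntegrable f volume x y ∧ F y - F x = ∫ t in x..y, f t

theorem AbsolutelyContinuousOnInterval.of_dist_le {X Y : Type*} [PseudoMetricSpace X]
    [PseudoMetricSpace Y] {f : ℝ → X} {g : ℝ → Y} {a b K : ℝ}
    (hf : AbsolutelyContinuousOnInterval f a b)
    (h : ∀ x ∈ uIcc a b, ∀ y ∈ uIcc a b, dist (g x) (g y) ≤ K * dist (f x) (f y)) :
    AbsolutelyContinuousOnInterval g a b := by
  have hf' := Tendsto.const_mul K hf
  rw [mul_zero] at hf'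
  refine tendsto_of_tendsto_of_tendsto_of_le_of_le' tendsto_const_nhds hf'
    (Eventually.of_forall fun _ => Finset.sum_nonneg fun _ _ => dist_nonneg) ?_
  filter_upwards [mem_inf_of_right (mem_principal_self _)] with E hE
  rw [Finset.mul_sum]
  exact Finset.sum_le_sum fun i hi => h _ (hE.1 i hi).1 _ (hE.1 i hi).2

namespace IsPrimitiveOn

variable {I J : Set ℝ} {F f : ℝ → E}

theorem mono (h : IsPrimitiveOn I F f) (hJ : J ⊆ I) : IsPrimitiveOn J F f :=
  fun x hx y hy => h x (hJ hx) y (hJ hy)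

theorem absolutelyContinuousOnInterval [hI : I.OrdConnected] (h : IsPrimitiveOn I F f) {x y : ℝ}
    (hx : x ∈ I) (hy : y ∈ I) : AbsolutelyContinuousOnInterval F x y := by
  have hn := (h x hx y hy).1.norm.absolutelyContinuousOnInterval_intervalIntegral
    (c := x) left_mem_uIcc
  refine hn.of_dist_le (K := 1) fun s hs t ht => ?_
  have hsI := hI.uIcc_subset hx hy hs
  have htI := hI.uIcc_subset hx hy ht
  rw [one_mul, dist_comm, dist_eq_norm, (h s hsI t htI).2, dist_comm, Real.dist_eq,
    intervalIntegral.integral_interval_sub_left (h x hx t htI).1.norm (h x hx s hsI).1.norm]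
  exact intervalIntegral.norm_integral_le_abs_integral_norm

theorem continuousOn_uIcc [I.OrdConnected] (h : IsPrimitiveOn I F f) {x y : ℝ}
    (hx : x ∈ I) (hy : y ∈ I) : ContinuousOn F (uIcc x y) :=
  (h.absolutelyContinuousOnInterval hx hy).continuousOn

theorem continuousOn [hI : I.OrdConnected] (h : IsPrimitiveOn I F f) (ho : IsOpen I) :
    ContinuousOn F I := by
  intro x hx
  obtain ⟨ε, hε, hb⟩ := Metric.isOpen_iff.1 ho x hx
  have h1 : x - ε / 2 ∈ I := hb (by simp [abs_of_pos hε, hε])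
  have h2 : x + ε / 2 ∈ I := hb (by simp [abs_of_pos hε, hε])
  refine ((h.continuousOn_uIcc h1 h2).continuousAt ?_).continuousWithinAt
  rw [uIcc_of_le (by linarith)]
  exact Icc_mem_nhds (by linarith) (by linarith)

theorem ae_hasDerivAt [CompleteSpace E] [hI : I.OrdConnected] (h : IsPrimitiveOn I F f) {x y : ℝ}
    (hx : x ∈ I) (hy : y ∈ I) : ∀ᵐ t, t ∈ uIcc x y → HasDerivAt F (f t) t := by
  have h₁ : ∀ᵐ t : ℝ, t ≠ x := by simp [ae_iff, measure_singleton]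
  have h₂ : ∀ᵐ t : ℝ, t ≠ y := by simp [ae_iff, measure_singleton]
  filter_upwards [(h x hx y hy).1.ae_hasDerivAt_integral, h₁, h₂] with t ht h₁ h₂ hm
  have hd := (ht hm x left_mem_uIcc).const_add (F x)
  refine hd.congr_of_eventuallyEq ?_
  have hn : uIcc x y ∈ 𝓝 t := by
    rcases le_total x y with hxy | hxy
    · rw [uIcc_of_le hxy] at hm ⊢
      exact Icc_mem_nhds (lt_of_le_of_ne hm.1 h₁.symm) (lt_of_le_of_ne hm.2 h₂)
    · rw [uIcc_of_ge hxy] at hm ⊢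
      exact Icc_mem_nhds (lt_of_le_of_ne hm.1 h₂.symm) (lt_of_le_of_ne hm.2 h₁)
  filter_upwards [hn] with s hs
  rw [← (h x hx s (hI.uIcc_subset hx hy hs)).2]
  abel

theorem of_absolutelyContinuous [CompleteSpace E]
    (hac : ∀ x ∈ I, ∀ y ∈ I, AbsolutelyContinuousOnInterval F x y)
    (hint : ∀ x ∈ I, ∀ y ∈ I, IntervalIntegrable f volume x y)
    (hd : ∀ x ∈ I, ∀ y ∈ I, ∀ᵐ t, t ∈ uIcc x y → HasDerivAt F (f t) t)
    [hI : I.OrdConnected] : IsPrimitiveOn I F f := by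
  intro x hx y hy
  refine ⟨hint x hx y hy, ?_⟩
  have hG : IsPrimitiveOn I (fun s => ∫ t in x..s, f t) f := fun s hs t ht =>
    ⟨hint s hs t ht,
      intervalIntegral.integral_interval_sub_left (hint x hx t ht) (hint x hx s hs)⟩
  obtain ⟨C, hC⟩ := ((hac x hx y hy).fun_sub
    (hG.absolutelyContinuousOnInterval hx hy)).const_of_ae_hasDerivAt_zero (by
      filter_upwards [hd x hx y hy, hG.ae_hasDerivAt hx hy] with t h1 h2 ht
      simpa using! (h1 ht).sub (h2 ht))
  have h1 := hC x left_mem_uIcc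
  have h2 := hC y right_mem_uIcc
  simp only [intervalIntegral.integral_same, sub_zero] at h1
  rw [h1, ← h2]
  abel

theorem congr {g : ℝ → E} (h : IsPrimitiveOn I F f) (hfg : ∀ t, f t = g t) :
    IsPrimitiveOn I F g := by
  rwa [← funext hfg]

theorem add {G g : ℝ → E} (hF : IsPrimitiveOn I F f) (hG : IsPrimitiveOn I G g) :
    IsPrimitiveOn I (fun t => F t + G t) (fun t => f t + g t) := fun x hx y hy =>
  ⟨(hF x hx y hy).1.add (hG x hx y hy).1, by
    rw [intervalIntegral.integral_add (hF x hx y hy).1 (hG x hx y hy).1, ← (hF x hx y hy).2,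
      ← (hG x hx y hy).2]
    exact add_sub_add_comm _ _ _ _⟩

theorem neg (hF : IsPrimitiveOn I F f) : IsPrimitiveOn I (fun t => -F t) (fun t => -f t) :=
  fun x hx y hy => ⟨(hF x hx y hy).1.neg, by
    rw [intervalIntegral.integral_neg, ← (hF x hx y hy).2]
    exact (neg_sub_neg _ _).trans (neg_sub _ _).symm⟩

theorem sub {G g : ℝ → E} (hF : IsPrimitiveOn I F f) (hG : IsPrimitiveOn I G g) :
    IsPrimitiveOn I (fun t => F t - G t) (fun t => f t - g t) := by
  simpa only [sub_eq_add_neg] using hF.add hG.neg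

theorem clm_comp {E' : Type*} [NormedAddCommGroup E'] [NormedSpace ℝ E'] [CompleteSpace E]
    [CompleteSpace E'] (L : E →L[ℝ] E') (hF : IsPrimitiveOn I F f) :
    IsPrimitiveOn I (fun t => L (F t)) (fun t => L (f t)) := fun x hx y hy =>
  ⟨⟨L.integrable_comp (hF x hx y hy).1.1, L.integrable_comp (hF x hx y hy).1.2⟩, by
    rw [L.intervalIntegral_comp_comm (hF x hx y hy).1, ← (hF x hx y hy).2, map_sub]⟩

theorem mul {𝕜 : Type*} [RCLike 𝕜] {F f G g : ℝ → 𝕜} [I.OrdConnected]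
    (hF : IsPrimitiveOn I F f) (hG : IsPrimitiveOn I G g) :
    IsPrimitiveOn I (fun t => F t * G t) (fun t => f t * G t + F t * g t) := by
  refine of_absolutelyContinuous
    (fun x hx y hy => (hF.absolutelyContinuousOnInterval hx hy).fun_smul
      (hG.absolutelyContinuousOnInterval hx hy))
    (fun x hx y hy => ?_) (fun x hx y hy => ?_)
  · exact ((hF x hx y hy).1.mul_continuousOn (hG.continuousOn_uIcc hx hy)).add
      ((hG x hx y hy).1.continuousOn_mul (hF.continuousOn_uIcc hx hy))
  · filter_upwards [hF.ae_hasDerivAt hx hy, hG.ae_hasDerivAt hx hy] with t h1 h2 ht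
    exact (h1 ht).mul (h2 ht)

theorem pow {K k : ℝ → ℝ} [I.OrdConnected] (hK : IsPrimitiveOn I K k) (n : ℕ) :
    IsPrimitiveOn I (fun t => K t ^ (n + 1)) (fun t => (n + 1) * (k t * K t ^ n)) := by
  induction n with
  | zero => simpa using hK
  | succ n ih =>
    have h := (ih.mul hK).congr (g := fun t => ((n + 1 : ℕ) + 1) * (k t * K t ^ (n + 1)))
      fun t => by push_cast; ring
    simpa only [pow_succ] using h

theorem inv {F f : ℝ → ℝ} [hI : I.OrdConnected] (hF : IsPrimitiveOn I F f)
    (h0 : ∀ x ∈ I, F x ≠ 0) :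
    IsPrimitiveOn I (fun t => (F t)⁻¹) (fun t => -f t / F t ^ 2) := by
  have hne : ∀ x ∈ I, ∀ y ∈ I, ∀ t ∈ uIcc x y, F t ≠ 0 := fun x hx y hy t ht =>
    h0 t (hI.uIcc_subset hx hy ht)
  refine of_absolutelyContinuous (fun x hx y hy => ?_) (fun x hx y hy => ?_)
    (fun x hx y hy => ?_)
  · have hc := hF.continuousOn_uIcc hx hy
    obtain ⟨C, hC⟩ := isCompact_uIcc.exists_bound_of_continuousOn (hc.inv₀ (hne x hx y hy))
    refine (hF.absolutelyContinuousOnInterval hx hy).of_dist_le (K := C * C) fun s hs t ht => ?_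
    have h1 := hne x hx y hy s hs
    have h2 := hne x hx y hy t ht
    have hst : (F s)⁻¹ - (F t)⁻¹ = (F s)⁻¹ * (F t)⁻¹ * (F t - F s) := by
      field_simp
    rw [Real.dist_eq, hst, dist_comm, Real.dist_eq, abs_mul, abs_mul]
    have h3 : |(F s)⁻¹| ≤ C := hC s hs
    have h4 : |(F t)⁻¹| ≤ C := hC t ht
    have : 0 ≤ C := (abs_nonneg _).trans h3
    gcongr
  · simp only [div_eq_mul_inv]
    exact (hF x hx y hy).1.neg.mul_continuousOn
      (((hF.continuousOn_uIcc hx hy).pow 2).inv₀ fun t ht => pow_ne_zero 2 (hne x hx y hy t ht))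
  · filter_upwards [hF.ae_hasDerivAt hx hy] with t h1 ht
    exact (h1 ht).inv (hne x hx y hy t ht)

theorem div {F f G g : ℝ → ℝ} [I.OrdConnected] (hF : IsPrimitiveOn I F f)
    (hG : IsPrimitiveOn I G g) (h0 : ∀ x ∈ I, G x ≠ 0) :
    IsPrimitiveOn I (fun t => F t / G t) (fun t => f t * (G t)⁻¹ + F t * (-g t / G t ^ 2)) := by
  simpa only [div_eq_mul_inv] using hF.mul (hG.inv h0)

end IsPrimitiveOn

/-- If the increments of `F` are the (possibly undefined) integrals of `f`, then `f` is integrable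
unless `F` is constant. -/
theorem isPrimitiveOn_or_const {I : Set ℝ} {F f : ℝ → E}
    (h : ∀ x ∈ I, ∀ y ∈ I, F y = F x + ∫ t in x..y, f t) :
    IsPrimitiveOn I F f ∨ ∃ C, ∀ x ∈ I, F x = C := by
  by_cases hint : ∀ x ∈ I, ∀ y ∈ I, IntervalIntegrable f volume x y
  · exact Or.inl fun x hx y hy => ⟨hint x hx y hy, by rw [h x hx y hy]; abel⟩
  · right
    push Not at hint
    obtain ⟨x, hx, y, hy, hxy⟩ := hint
    have key : ∀ s ∈ I, ∀ t ∈ I, ¬ IntervalIntegrable f volume s t → F t = F s := by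
      intro s hs t ht hst
      rw [h s hs t ht, intervalIntegral.integral_undef hst, add_zero]
    refine ⟨F x, fun m hm => ?_⟩
    by_cases h1 : IntervalIntegrable f volume x m
    · have h2 : ¬ IntervalIntegrable f volume m y := fun h2 => hxy (h1.trans h2)
      rw [← key m hm y hy h2, key x hx y hy hxy]
    · exact key x hx m hm h1

end Primitive

/-! ### First-order Sturm–Liouville systems -/

section System

variable {𝕜 : Type*} [RCLike 𝕜] {I : Set ℝ}

/-- `(u, v)` solves the first-order system `u' = P v`, `v' = Q u` on `I` in the sense of
absolutely continuous functions. -/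
def IsSystemSolution (I : Set ℝ) (P Q u v : ℝ → 𝕜) : Prop :=
  IsPrimitiveOn I u (fun t => P t * v t) ∧ IsPrimitiveOn I v (fun t => Q t * u t)

/-- Integrability of the integrands is automatic for a solution of the integral equations. -/
theorem isSystemSolution_of_integral_eq [hI : I.OrdConnected] {P Q u v : ℝ → 𝕜}
    (hP : ∀ x ∈ I, ∀ y ∈ I, IntervalIntegrable P volume x y)
    (hQ : ∀ x ∈ I, ∀ y ∈ I, IntervalIntegrable Q volume x y)
    (hu : ∀ x ∈ I, ∀ y ∈ I, u y = u x + ∫ t in x..y, P t * v t)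
    (hv : ∀ x ∈ I, ∀ y ∈ I, v y = v x + ∫ t in x..y, Q t * u t) :
    IsSystemSolution I P Q u v := by
  have prim : ∀ {R w W : ℝ → 𝕜}, (∀ x ∈ I, ∀ y ∈ I, IntervalIntegrable R volume x y) →
      (∀ x ∈ I, ∀ y ∈ I, ContinuousOn w (uIcc x y)) →
      (∀ x ∈ I, ∀ y ∈ I, W y = W x + ∫ t in x..y, R t * w t) →
      IsPrimitiveOn I W (fun t => R t * w t) := fun hR hw hW x hx y hy =>
    ⟨(hR x hx y hy).mul_continuousOn (hw x hx y hy), by rw [hW x hx y hy, add_sub_cancel_left]⟩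
  rcases isPrimitiveOn_or_const hu with h | ⟨C, hC⟩
  · exact ⟨h, prim hQ (fun x hx y hy => h.continuousOn_uIcc hx hy) hv⟩
  · have h := prim hQ (fun x hx y hy => continuousOn_const.congr fun t ht =>
      hC t (hI.uIcc_subset hx hy ht)) hv
    exact ⟨prim hP (fun x hx y hy => h.continuousOn_uIcc hx hy) hu, h⟩

theorem abs_integral_mul_abs_pow [hI : I.OrdConnected] {K k : ℝ → ℝ} (hK : IsPrimitiveOn I K k)
    (hk : ∀ t, 0 ≤ k t) {c x : ℝ} (hc : c ∈ I) (hx : x ∈ I) (hKc : K c = 0) (n : ℕ) :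
    |∫ t in c..x, k t * |K t| ^ n| = |K x| ^ (n + 1) / (n + 1) := by
  obtain ⟨s, hs, hsK⟩ : ∃ s : ℝ, |s| = 1 ∧ ∀ t ∈ uIcc c x, |K t| = s * K t := by
    rcases le_total c x with hcx | hcx
    · refine ⟨1, by simp, fun t ht => ?_⟩
      have h := (hK c hc t (hI.uIcc_subset hc hx ht)).2
      rw [uIcc_of_le hcx] at ht
      have h0 : 0 ≤ ∫ t in c..t, k t := intervalIntegral.integral_nonneg ht.1 fun s _ => hk s
      rw [one_mul, abs_of_nonneg (by linarith)]
    · refine ⟨-1, by simp, fun t ht => ?_⟩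
      have h := (hK t (hI.uIcc_subset hc hx ht) c hc).2
      rw [uIcc_of_ge hcx] at ht
      have h0 : 0 ≤ ∫ t in t..c, k t := intervalIntegral.integral_nonneg ht.2 fun s _ => hk s
      rw [neg_one_mul, abs_of_nonpos (by linarith)]
  have h1 : ∫ t in c..x, k t * |K t| ^ n = s ^ n * ∫ t in c..x, k t * K t ^ n := by
    rw [← intervalIntegral.integral_const_mul]
    refine intervalIntegral.integral_congr fun t ht => ?_
    simp only [hsK t ht, mul_pow]
    ring
  have h2 := ((hK.pow n) c hc x hx).2
  simp only [hKc, intervalIntegral.integral_const_mul] at h2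
  have h3 : ∫ t in c..x, k t * K t ^ n = K x ^ (n + 1) / (n + 1) := by
    rw [eq_div_iff (by positivity), mul_comm, ← h2]
    simp
  rw [h1, h3, abs_mul, abs_pow, hs, one_pow, one_mul, abs_div, abs_pow,
    abs_of_pos (by positivity : (0 : ℝ) < n + 1)]

/-- Picard increments for the system `u' = P v`, `v' = Q u` with data `(α, β)` at `c`. -/
def picardTerm (P Q : ℝ → 𝕜) (c : ℝ) (α β : 𝕜) : ℕ → (ℝ → 𝕜) × (ℝ → 𝕜)
  | 0 => (fun _ => α, fun _ => β)
  | n + 1 => (fun x => ∫ t in c..x, P t * (picardTerm P Q c α β n).2 t,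
      fun x => ∫ t in c..x, Q t * (picardTerm P Q c α β n).1 t)

/-- One Picard step improves a bound `C |K|ⁿ / n!` to `C |K|ⁿ⁺¹ / (n + 1)!`. -/
theorem picard_step [hI : I.OrdConnected] {K k : ℝ → ℝ} (hK : IsPrimitiveOn I K k)
    (hk : ∀ t, 0 ≤ k t) {c : ℝ} (hc : c ∈ I) (hKc : K c = 0) {C : ℝ} (hC : 0 ≤ C) (n : ℕ)
    {R w : ℝ → 𝕜} (hR : ∀ x ∈ I, ∀ y ∈ I, IntervalIntegrable R volume x y)
    (hRk : ∀ t, ‖R t‖ ≤ k t) (hw : ∀ x ∈ I, ∀ y ∈ I, ContinuousOn w (uIcc x y))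
    (hb : ∀ t ∈ I, ‖w t‖ ≤ C * (|K t| ^ n / n.factorial)) :
    (∀ x ∈ I, ∀ y ∈ I, ContinuousOn (fun x => ∫ t in c..x, R t * w t) (uIcc x y)) ∧
    ∀ x ∈ I, ‖∫ t in c..x, R t * w t‖ ≤ C * (|K x| ^ (n + 1) / (n + 1).factorial) := by
  have hint : ∀ x ∈ I, ∀ y ∈ I, IntervalIntegrable (fun t => R t * w t) volume x y :=
    fun x hx y hy => (hR x hx y hy).mul_continuousOn (hw x hx y hy)
  have hprim : IsPrimitiveOn I (fun x => ∫ t in c..x, R t * w t) (fun t => R t * w t) :=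
    fun x hx y hy => ⟨hint x hx y hy,
      intervalIntegral.integral_interval_sub_left (hint c hc y hy) (hint c hc x hx)⟩
  refine ⟨fun x hx y hy => hprim.continuousOn_uIcc hx hy, fun x hx => ?_⟩
  have hbd : IntervalIntegrable (fun t => C / n.factorial * (k t * |K t| ^ n)) volume c x :=
    ((hK c hc x hx).1.mul_continuousOn ((hK.continuousOn_uIcc hc hx).abs.pow n)).const_mul _
  calc ‖∫ t in c..x, R t * w t‖ ≤ |∫ t in c..x, C / n.factorial * (k t * |K t| ^ n)| := by
        refine intervalIntegral.norm_integral_le_abs_of_norm_le ?_ hbd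
        refine (ae_restrict_mem measurableSet_uIoc).mono fun t ht => ?_
        have htI := hI.uIcc_subset hc hx (uIoc_subset_uIcc ht)
        rw [norm_mul]
        calc ‖R t‖ * ‖w t‖ ≤ k t * (C * (|K t| ^ n / n.factorial)) := by
              gcongr
              · exact hk t
              · exact hRk t
              · exact hb t htI
          _ = C / n.factorial * (k t * |K t| ^ n) := by ring
    _ = C * (|K x| ^ (n + 1) / (n + 1).factorial) := by
        rw [intervalIntegral.integral_const_mul, abs_mul, abs_integral_mul_abs_pow hK hk hc hx hKc,
          abs_of_nonneg (by positivity), Nat.factorial_succ]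
        push_cast
        field_simp

/-- Global existence for linear systems with locally integrable coefficients. -/
theorem exists_isSystemSolution [hI : I.OrdConnected] {P Q : ℝ → 𝕜}
    (hP : ∀ x ∈ I, ∀ y ∈ I, IntervalIntegrable P volume x y)
    (hQ : ∀ x ∈ I, ∀ y ∈ I, IntervalIntegrable Q volume x y) {c : ℝ} (hc : c ∈ I) (α β : 𝕜) :
    ∃ u v : ℝ → 𝕜, IsSystemSolution I P Q u v ∧ u c = α ∧ v c = β := by
  set k : ℝ → ℝ := fun t => ‖P t‖ + ‖Q t‖ with hk_def
  set K : ℝ → ℝ := fun x => ∫ t in c..x, k t with hK_def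
  have hkint : ∀ x ∈ I, ∀ y ∈ I, IntervalIntegrable k volume x y := fun x hx y hy =>
    (hP x hx y hy).norm.add (hQ x hx y hy).norm
  have hK : IsPrimitiveOn I K k := fun x hx y hy => ⟨hkint x hx y hy,
    intervalIntegral.integral_interval_sub_left (hkint c hc y hy) (hkint c hc x hx)⟩
  have hk : ∀ t, 0 ≤ k t := fun t => by positivity
  have hKc : K c = 0 := intervalIntegral.integral_same
  have hPk : ∀ t, ‖P t‖ ≤ k t := fun t => le_add_of_nonneg_right (norm_nonneg _)
  have hQk : ∀ t, ‖Q t‖ ≤ k t := fun t => le_add_of_nonneg_left (norm_nonneg _)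
  set C : ℝ := max ‖α‖ ‖β‖
  have hC : 0 ≤ C := le_max_of_le_left (norm_nonneg _)
  set S := picardTerm P Q c α β with hS
  have hbound : ∀ n,
      ((∀ x ∈ I, ∀ y ∈ I, ContinuousOn (S n).1 (uIcc x y)) ∧
        ∀ x ∈ I, ‖(S n).1 x‖ ≤ C * (|K x| ^ n / n.factorial)) ∧
      ((∀ x ∈ I, ∀ y ∈ I, ContinuousOn (S n).2 (uIcc x y)) ∧
        ∀ x ∈ I, ‖(S n).2 x‖ ≤ C * (|K x| ^ n / n.factorial)) := by
    intro n
    induction n with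
    | zero =>
      simp only [hS, picardTerm, pow_zero, Nat.factorial_zero, Nat.cast_one, div_one, mul_one]
      exact ⟨⟨fun _ _ _ _ => continuousOn_const, fun _ _ => le_max_left _ _⟩,
        fun _ _ _ _ => continuousOn_const, fun _ _ => le_max_right _ _⟩
    | succ n ih =>
      exact ⟨picard_step hK hk hc hKc hC n hP hPk ih.2.1 ih.2.2,
        picard_step hK hk hc hKc hC n hQ hQk ih.1.1 ih.1.2⟩
  have hunif : ∀ x ∈ I, ∀ y ∈ I, ∃ M : ℝ, ∀ t ∈ uIcc x y, ∀ n,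
      ‖(S n).1 t‖ ≤ C * (M ^ n / n.factorial) ∧ ‖(S n).2 t‖ ≤ C * (M ^ n / n.factorial) := by
    intro x hx y hy
    obtain ⟨M, hM⟩ := (hK.absolutelyContinuousOnInterval hx hy).exists_bound
    refine ⟨M, fun t ht n => ?_⟩
    have htI := hI.uIcc_subset hx hy ht
    have h1 : C * (|K t| ^ n / n.factorial) ≤ C * (M ^ n / n.factorial) := by
      gcongr
      exact hM t ht
    exact ⟨((hbound n).1.2 t htI).trans h1, ((hbound n).2.2 t htI).trans h1⟩
  have hsum : ∀ M : ℝ, Summable fun n : ℕ => C * (M ^ n / n.factorial) := fun M =>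
    (Real.summable_pow_div_factorial M).mul_left C
  set u : ℝ → 𝕜 := fun x => ∑' n, (S n).1 x with hu
  set v : ℝ → 𝕜 := fun x => ∑' n, (S n).2 x with hv
  have hu_sum : ∀ x ∈ I, HasSum (fun n => (S n).1 x) (u x) := fun x hx => by
    obtain ⟨M, hM⟩ := hunif x hx x hx
    exact ((hsum M).of_norm_bounded fun n => (hM x left_mem_uIcc n).1).hasSum
  have hv_sum : ∀ x ∈ I, HasSum (fun n => (S n).2 x) (v x) := fun x hx => by
    obtain ⟨M, hM⟩ := hunif x hx x hx
    exact ((hsum M).of_norm_bounded fun n => (hM x left_mem_uIcc n).2).hasSum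
  have hu_cont : ∀ x ∈ I, ∀ y ∈ I, ContinuousOn u (uIcc x y) := fun x hx y hy => by
    obtain ⟨M, hM⟩ := hunif x hx y hy
    exact continuousOn_tsum (fun n => (hbound n).1.1 x hx y hy) (hsum M)
      fun n t ht => (hM t ht n).1
  have hv_cont : ∀ x ∈ I, ∀ y ∈ I, ContinuousOn v (uIcc x y) := fun x hx y hy => by
    obtain ⟨M, hM⟩ := hunif x hx y hy
    exact continuousOn_tsum (fun n => (hbound n).2.1 x hx y hy) (hsum M)
      fun n t ht => (hM t ht n).2
  have swap : ∀ {R w : ℝ → 𝕜} {T : ℕ → ℝ → 𝕜},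
      (∀ x ∈ I, ∀ y ∈ I, IntervalIntegrable R volume x y) →
      (∀ n, ∀ x ∈ I, ∀ y ∈ I, ContinuousOn (T n) (uIcc x y)) →
      (∀ x ∈ I, HasSum (fun n => T n x) (w x)) →
      (∀ x ∈ I, ∀ y ∈ I, ∃ M : ℝ, ∀ t ∈ uIcc x y, ∀ n, ‖T n t‖ ≤ C * (M ^ n / n.factorial)) →
      ∀ x ∈ I, HasSum (fun n => ∫ t in c..x, R t * T n t) (∫ t in c..x, R t * w t) := by
    intro R w T hR hT hw hbd x hx
    obtain ⟨M, hM⟩ := hbd c hc x hx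
    refine intervalIntegral.hasSum_integral_of_dominated_convergence
      (fun n t => ‖R t‖ * (C * (M ^ n / n.factorial))) (fun n => ?_) (fun n => ?_) ?_ ?_ ?_
    · exact ((hR c hc x hx).mul_continuousOn (hT n c hc x hx)).def'.aestronglyMeasurable
    · refine Eventually.of_forall fun t ht => ?_
      rw [norm_mul]
      exact mul_le_mul_of_nonneg_left (hM t (uIoc_subset_uIcc ht) n) (norm_nonneg _)
    · exact Eventually.of_forall fun t _ => (hsum M).mul_left _
    · simp only [tsum_mul_left]
      exact (hR c hc x hx).norm.mul_const _
    · exact Eventually.of_forall fun t ht =>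
        (hw t (hI.uIcc_subset hc hx (uIoc_subset_uIcc ht))).mul_left _
  have hu_eq : ∀ x ∈ I, u x = α + ∫ t in c..x, P t * v t := fun x hx => by
    have h := swap hP (fun n => (hbound n).2.1) hv_sum (fun x hx y hy =>
      (hunif x hx y hy).imp fun M hM t ht n => (hM t ht n).2) x hx
    rw [← h.tsum_eq]
    exact (hu_sum x hx).summable.tsum_eq_zero_add
  have hv_eq : ∀ x ∈ I, v x = β + ∫ t in c..x, Q t * u t := fun x hx => by
    have h := swap hQ (fun n => (hbound n).1.1) hu_sum (fun x hx y hy =>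
      (hunif x hx y hy).imp fun M hM t ht n => (hM t ht n).1) x hx
    rw [← h.tsum_eq]
    exact (hv_sum x hx).summable.tsum_eq_zero_add
  have hPv : ∀ x ∈ I, ∀ y ∈ I, IntervalIntegrable (fun t => P t * v t) volume x y :=
    fun x hx y hy => (hP x hx y hy).mul_continuousOn (hv_cont x hx y hy)
  have hQu : ∀ x ∈ I, ∀ y ∈ I, IntervalIntegrable (fun t => Q t * u t) volume x y :=
    fun x hx y hy => (hQ x hx y hy).mul_continuousOn (hu_cont x hx y hy)
  refine ⟨u, v, ⟨fun x hx y hy => ⟨hPv x hx y hy, ?_⟩, fun x hx y hy => ⟨hQu x hx y hy, ?_⟩⟩,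
    by simp [hu_eq c hc], by simp [hv_eq c hc]⟩
  · rw [hu_eq x hx, hu_eq y hy, add_sub_add_left_eq_sub]
    exact intervalIntegral.integral_interval_sub_left (hPv c hc y hy) (hPv c hc x hx)
  · rw [hv_eq x hx, hv_eq y hy, add_sub_add_left_eq_sub]
    exact intervalIntegral.integral_interval_sub_left (hQu c hc y hy) (hQu c hc x hx)

namespace IsSystemSolution

variable {P Q : ℝ → 𝕜} {u v : ℝ → 𝕜}

theorem mono {J : Set ℝ} (h : IsSystemSolution I P Q u v) (hJ : J ⊆ I) :
    IsSystemSolution J P Q u v :=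
  ⟨h.1.mono hJ, h.2.mono hJ⟩

theorem neg (h : IsSystemSolution I P Q u v) :
    IsSystemSolution I P Q (fun t => -u t) (fun t => -v t) :=
  ⟨h.1.neg.congr fun t => by ring, h.2.neg.congr fun t => by ring⟩

/-- The derivative of the Wronskian of solutions of two systems with the same `P`. -/
theorem wronskian [I.OrdConnected] {Q₁ Q₂ u₁ v₁ u₂ v₂ : ℝ → 𝕜}
    (h₁ : IsSystemSolution I P Q₁ u₁ v₁) (h₂ : IsSystemSolution I P Q₂ u₂ v₂) :
    IsPrimitiveOn I (fun t => u₁ t * v₂ t - v₁ t * u₂ t)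
      (fun t => (Q₂ t - Q₁ t) * (u₁ t * u₂ t)) :=
  ((h₁.1.mul h₂.2).sub (h₁.2.mul h₂.1)).congr fun t => by ring

/-- The Wronskian of two solutions of the same system is constant. -/
theorem wronskian_eq [I.OrdConnected] {u₁ v₁ u₂ v₂ : ℝ → 𝕜}
    (h₁ : IsSystemSolution I P Q u₁ v₁) (h₂ : IsSystemSolution I P Q u₂ v₂) {x y : ℝ}
    (hx : x ∈ I) (hy : y ∈ I) : u₁ y * v₂ y - v₁ y * u₂ y = u₁ x * v₂ x - v₁ x * u₂ x := by
  simpa [sub_eq_zero] using ((h₁.wronskian h₂) x hx y hy).2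

end IsSystemSolution

end System

/-! ### Comparison of real solutions -/

section Comparison

variable {I : Set ℝ} [hI : I.OrdConnected] {P Q Q₁ Q₂ u₁ v₁ u₂ v₂ : ℝ → ℝ}

/-- If `Q₁ ≤ Q₂` and the solutions agree at `d`, then `u₂` dominates the positive solution `u₁`
at `s`, provided `u₂ ≥ 0` between `s` and `d`. -/
theorem IsSystemSolution.le_of_nonneg
    (h₁ : IsSystemSolution I P Q₁ u₁ v₁) (h₂ : IsSystemSolution I P Q₂ u₂ v₂)
    (hP : ∀ᵐ t, t ∈ I → 0 ≤ P t) (hQ : ∀ᵐ t, t ∈ I → Q₁ t ≤ Q₂ t) {s d : ℝ} (hs : s ∈ I)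
    (hd : d ∈ I) (hsd : s ≤ d) (hpos : ∀ t ∈ I, t ≤ d → 0 < u₁ t) (hu : u₂ d = u₁ d)
    (hv : v₂ d = v₁ d) (hnn : ∀ t ∈ Ioc s d, 0 ≤ u₂ t) : u₁ s ≤ u₂ s := by
  have hsub : ∀ {x}, x ∈ Icc s d → x ∈ I := fun hx => hI.out hs hd hx
  have hW : ∀ x ∈ Ioc s d, u₁ x * v₂ x - v₁ x * u₂ x ≤ 0 := by
    intro x hx
    have hxI := hsub (Ioc_subset_Icc_self hx)
    have h := ((h₁.wronskian h₂) x hxI d hd).2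
    have h0 : 0 ≤ ∫ t in x..d, (Q₂ t - Q₁ t) * (u₁ t * u₂ t) := by
      refine intervalIntegral.integral_nonneg_of_ae_restrict hx.2 ?_
      refine (ae_restrict_iff' measurableSet_Icc).2 (hQ.mono fun t ht htx => ?_)
      have htI : t ∈ I := hI.out hxI hd htx
      exact mul_nonneg (sub_nonneg.2 (ht htI))
        (mul_nonneg (hpos t htI htx.2).le (hnn t ⟨hx.1.trans_le htx.1, htx.2⟩))
    rw [← h] at h0
    beta_reduce at h0
    rw [hu, hv] at h0
    linarith [mul_comm (u₁ d) (v₁ d)]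
  have hdiv := ((h₂.mono (inter_subset_left (t := Iic d))).1.div
    (h₁.mono (inter_subset_left (t := Iic d))).1 fun x hx => (hpos x hx.1 hx.2).ne') s ⟨hs, hsd⟩ d
    ⟨hd, le_refl d⟩
  have h0 : ∫ t in s..d, (P t * v₂ t * (u₁ t)⁻¹ + u₂ t * (-(P t * v₁ t) / u₁ t ^ 2)) ≤ 0 := by
    rw [intervalIntegral.integral_of_le hsd]
    refine integral_nonpos_of_ae ((ae_restrict_iff' measurableSet_Ioc).2
      (hP.mono fun t ht htx => ?_))
    have htI := hsub (Ioc_subset_Icc_self htx)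
    have hp := hpos t htI htx.2
    have : P t * v₂ t * (u₁ t)⁻¹ + u₂ t * (-(P t * v₁ t) / u₁ t ^ 2) =
        P t / u₁ t ^ 2 * (u₁ t * v₂ t - v₁ t * u₂ t) := by
      field_simp
      ring
    simp only [Pi.zero_apply, this]
    exact mul_nonpos_of_nonneg_of_nonpos (div_nonneg (ht htI) (sq_nonneg _)) (hW t htx)
  rw [← hdiv.2] at h0
  beta_reduce at h0
  rw [hu, div_self (hpos d hd le_rfl).ne', sub_nonpos, one_le_div (hpos s hs hsd)] at h0
  exact h0

/-- Sturm-type comparison: a positive solution of the smaller equation is dominated to the left of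
`d` by the solution of the larger equation with the same data at `d`. -/
theorem IsSystemSolution.le_of_potential_le
    (h₁ : IsSystemSolution I P Q₁ u₁ v₁) (h₂ : IsSystemSolution I P Q₂ u₂ v₂)
    (hP : ∀ᵐ t, t ∈ I → 0 ≤ P t) (hQ : ∀ᵐ t, t ∈ I → Q₁ t ≤ Q₂ t) {d : ℝ}
    (hd : d ∈ I) (hpos : ∀ t ∈ I, t ≤ d → 0 < u₁ t) (hu : u₂ d = u₁ d)
    (hv : v₂ d = v₁ d) {x : ℝ} (hx : x ∈ I) (hxd : x ≤ d) : u₁ x ≤ u₂ x := by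
  refine h₁.le_of_nonneg h₂ hP hQ hx hd hxd hpos hu hv fun t ht => ?_
  by_contra! hneg
  have hc : ContinuousOn u₂ (Icc x d) := uIcc_of_le hxd ▸ h₂.1.continuousOn_uIcc hx hd
  have hcomp : IsCompact (Icc x d ∩ u₂ ⁻¹' Iic 0) :=
    isCompact_Icc.of_isClosed_subset (hc.preimage_isClosed_of_isClosed isClosed_Icc isClosed_Iic)
      inter_subset_left
  obtain ⟨s, hs⟩ := hcomp.exists_isGreatest ⟨t, Ioc_subset_Icc_self ht, hneg.le⟩
  have hsI : s ∈ I := hI.out hx hd hs.1.1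
  have hle := h₁.le_of_nonneg h₂ hP hQ hsI hd hs.1.1.2 hpos hu hv fun r hr => by
    by_contra! hr'
    exact hr.1.not_ge (hs.2 ⟨⟨hs.1.1.1.trans hr.1.le, hr.2⟩, hr'.le⟩)
  exact (hpos s hsI hs.1.1.2).not_ge (hle.trans hs.1.2)

/-- If the equation has a solution that is positive to the left of `d`, then every solution has
constant sign near the left endpoint. -/
theorem IsSystemSolution.eventually_sign {w y : ℝ → ℝ}
    (h₁ : IsSystemSolution I P Q u₁ v₁) (h₂ : IsSystemSolution I P Q w y)
    (hP : ∀ᵐ t, t ∈ I → 0 ≤ P t) {d : ℝ} (hd : d ∈ I) (hpos : ∀ t ∈ I, t ≤ d → 0 < u₁ t) :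
    ∃ e ∈ I, (∀ t ∈ I, t ≤ e → 0 < w t) ∨ (∀ t ∈ I, t ≤ e → w t < 0) ∨
      ∀ t ∈ I, t ≤ e → w t = 0 := by
  wlog hC : 0 ≤ u₁ d * y d - v₁ d * w d generalizing w y
  · obtain ⟨e, he, h⟩ := this h₂.neg (by linarith)
    refine ⟨e, he, ?_⟩
    rcases h with h | h | h
    · exact Or.inr (Or.inl fun t ht hte => neg_pos.1 (h t ht hte))
    · exact Or.inl fun t ht hte => neg_lt_zero.1 (h t ht hte)
    · exact Or.inr (Or.inr fun t ht hte => neg_eq_zero.1 (h t ht hte))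
  have hmono : ∀ s ∈ I, ∀ t ∈ I, s ≤ t → t ≤ d → w s / u₁ s ≤ w t / u₁ t := by
    intro s hs t ht hst htd
    have hdiv := ((h₂.mono (inter_subset_left (t := Iic d))).1.div
      (h₁.mono (inter_subset_left (t := Iic d))).1 fun x hx => (hpos x hx.1 hx.2).ne') s
      ⟨hs, hst.trans htd⟩ t ⟨ht, htd⟩
    rw [← sub_nonneg, hdiv.2]
    refine intervalIntegral.integral_nonneg_of_ae_restrict hst
      ((ae_restrict_iff' measurableSet_Icc).2 (hP.mono fun x hx hxst => ?_))
    have hxI : x ∈ I := hI.out hs ht hxst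
    have hp := hpos x hxI (hxst.2.trans htd)
    have : P x * y x * (u₁ x)⁻¹ + w x * (-(P x * v₁ x) / u₁ x ^ 2) =
        P x / u₁ x ^ 2 * (u₁ x * y x - v₁ x * w x) := by
      field_simp
      ring
    simp only [Pi.zero_apply, this, h₁.wronskian_eq h₂ hd hxI]
    exact mul_nonneg (div_nonneg (hx hxI) (sq_nonneg _)) hC
  by_cases hneg : ∃ e ∈ I, e ≤ d ∧ w e < 0
  · obtain ⟨e, he, hed, hwe⟩ := hneg
    refine ⟨e, he, Or.inr (Or.inl fun t ht hte => ?_)⟩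
    have h := (hmono t ht e he hte hed).trans_lt (div_neg_of_neg_of_pos hwe (hpos e he hed))
    simpa using (div_lt_iff₀ (hpos t ht (hte.trans hed))).1 h
  push Not at hneg
  by_cases hz : ∃ e ∈ I, e ≤ d ∧ w e = 0
  · obtain ⟨e, he, hed, hwe⟩ := hz
    refine ⟨e, he, Or.inr (Or.inr fun t ht hte => le_antisymm ?_ (hneg t ht (hte.trans hed)))⟩
    have h := hmono t ht e he hte hed
    rw [hwe, zero_div] at h
    simpa using (div_le_iff₀ (hpos t ht (hte.trans hed))).1 h
  · push Not at hz
    exact ⟨d, hd, Or.inl fun t ht htd => lt_of_le_of_ne (hneg t ht htd) (hz t ht htd).symm⟩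

end Comparison

/-! ### Weighted square integrability near the left endpoint -/

section WeightedSquare

variable {𝕜 : Type*} [RCLike 𝕜] {I : Set ℝ} {r : ℝ → ℝ}

/-- The squared norm of `u` in `L²(S; r dx)`. -/
def weightedSq (r : ℝ → ℝ) (u : ℝ → 𝕜) (S : Set ℝ) : ℝ≥0∞ :=
  ∫⁻ x in S, (‖u x‖₊ : ℝ≥0∞) ^ 2 * ENNReal.ofReal (r x)

theorem weightedSq_uIcc_ne_top {u : ℝ → 𝕜} {x y : ℝ} (hr : IntervalIntegrable r volume x y)
    (hu : ContinuousOn u (uIcc x y)) : weightedSq r u (uIcc x y) ≠ ⊤ := by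
  obtain ⟨B, hB⟩ := isCompact_uIcc.exists_bound_of_continuousOn hu
  have hri : IntegrableOn r (uIcc x y) := by
    rw [uIcc, integrableOn_Icc_iff_integrableOn_Ioc]
    exact hr.def'
  refine (lt_of_le_of_lt (setLIntegral_mono' measurableSet_Icc
    (g := fun x => ENNReal.ofReal B ^ 2 * ENNReal.ofReal (r x)) fun t ht => ?_) ?_).ne
  · gcongr
    rw [← enorm_eq_nnnorm, ← ofReal_norm]
    exact ENNReal.ofReal_le_ofReal (hB t ht)
  · rw [lintegral_const_mul' _ _ (by finiteness)]
    exact ENNReal.mul_lt_top (by finiteness) (Integrable.lintegral_lt_top hri)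

theorem weightedSq_Iio_eq_top [hI : I.OrdConnected] {u : ℝ → 𝕜}
    (hr : ∀ x ∈ I, ∀ y ∈ I, IntervalIntegrable r volume x y) (hu : ContinuousOn u I) {c d : ℝ}
    (hc : c ∈ I) (hd : d ∈ I) (h : weightedSq r u (I ∩ Iio c) = ⊤) :
    weightedSq r u (I ∩ Iio d) = ⊤ := by
  by_contra hne
  have hsub : I ∩ Iio c ⊆ (I ∩ Iio d) ∪ uIcc d c := by
    intro x hx
    rcases lt_or_ge x d with hxd | hxd
    · exact Or.inl ⟨hx.1, hxd⟩
    · exact Or.inr (Icc_subset_uIcc ⟨hxd, le_of_lt hx.2⟩)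
  have h1 : weightedSq r u (I ∩ Iio c) ≤
      weightedSq r u (I ∩ Iio d) + weightedSq r u (uIcc d c) :=
    (lintegral_mono_set hsub).trans (lintegral_union_le _ _ _)
  rw [h, top_le_iff, ENNReal.add_eq_top] at h1
  exact h1.elim hne
    (weightedSq_uIcc_ne_top (hr d hd c hc) (hu.mono (hI.uIcc_subset hd hc)))

theorem intervalIntegral_normSq_mul_le [hI : I.OrdConnected] {u : ℝ → 𝕜}
    (hr : ∀ x ∈ I, ∀ y ∈ I, IntervalIntegrable r volume x y) (hr0 : ∀ᵐ t, t ∈ I → 0 ≤ r t)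
    (hu : ContinuousOn u I) {d : ℝ} (hd : d ∈ I) (h : weightedSq r u (I ∩ Iio d) ≠ ⊤) {x : ℝ}
    (hx : x ∈ I) (hxd : x ≤ d) :
    ∫ t in x..d, r t * ‖u t‖ ^ 2 ≤ (weightedSq r u (I ∩ Iio d)).toReal := by
  have hsub : Ioo x d ⊆ I ∩ Iio d := fun t ht => ⟨hI.out hx hd (Ioo_subset_Icc_self ht), ht.2⟩
  have hint : IntervalIntegrable (fun t => r t * ‖u t‖ ^ 2) volume x d :=
    (hr x hx d hd).mul_continuousOn ((hu.mono (hI.uIcc_subset hx hd)).norm.pow 2)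
  rw [intervalIntegrable_iff_integrableOn_Ioo_of_le hxd] at hint
  rw [intervalIntegral.integral_of_le hxd, integral_Ioc_eq_integral_Ioo,
    integral_eq_lintegral_of_nonneg_ae ?_ hint.aestronglyMeasurable]
  · refine ENNReal.toReal_mono h ((lintegral_mono fun t => ?_).trans (lintegral_mono_set hsub))
    rw [mul_comm, ENNReal.ofReal_mul (by positivity), ENNReal.ofReal_pow (norm_nonneg _),
      ofReal_norm, enorm_eq_nnnorm]
  · exact (ae_restrict_iff' measurableSet_Ioo).2
      (hr0.mono fun t ht htx => mul_nonneg (ht (hsub htx).1) (sq_nonneg _))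

theorem aemeasurable_weightedSq_integrand {u : ℝ → 𝕜} (hrm : Measurable r) {S : Set ℝ}
    (hS : MeasurableSet S) (hu : ContinuousOn u S) :
    AEMeasurable (fun x => (‖u x‖₊ : ℝ≥0∞) ^ 2 * ENNReal.ofReal (r x)) (volume.restrict S) :=
  ((hu.aemeasurable hS).nnnorm.coe_nnreal_ennreal.pow_const 2).mul
    hrm.ennreal_ofReal.aemeasurable

/-- Pointwise domination by two functions in `L²(S; r dx)`. -/
theorem weightedSq_ne_top_of_norm_le {𝕜₁ 𝕜₂ : Type*} [RCLike 𝕜₁] [RCLike 𝕜₂] {u : ℝ → 𝕜}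
    {f : ℝ → 𝕜₁} {g : ℝ → 𝕜₂} (hrm : Measurable r) {S : Set ℝ} (hS : MeasurableSet S)
    (hf : ContinuousOn f S) {B : ℝ} (hle : ∀ t ∈ S, ‖u t‖ ≤ (‖f t‖ + ‖g t‖) * B)
    (hf' : weightedSq r f S ≠ ⊤) (hg' : weightedSq r g S ≠ ⊤) : weightedSq r u S ≠ ⊤ := by
  have hpt : ∀ t ∈ S, (‖u t‖₊ : ℝ≥0∞) ^ 2 * ENNReal.ofReal (r t) ≤
      ENNReal.ofReal (2 * B ^ 2) * ((‖f t‖₊ : ℝ≥0∞) ^ 2 * ENNReal.ofReal (r t) +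
        (‖g t‖₊ : ℝ≥0∞) ^ 2 * ENNReal.ofReal (r t)) := by
    intro t ht
    rw [← add_mul, ← mul_assoc]
    gcongr
    simp only [← enorm_eq_nnnorm, ← ofReal_norm]
    rw [← ENNReal.ofReal_pow (norm_nonneg _), ← ENNReal.ofReal_pow (norm_nonneg _),
      ← ENNReal.ofReal_pow (norm_nonneg _), ← ENNReal.ofReal_add (by positivity) (by positivity),
      ← ENNReal.ofReal_mul (by positivity)]
    refine ENNReal.ofReal_le_ofReal ?_
    calc ‖u t‖ ^ 2 ≤ ((‖f t‖ + ‖g t‖) * B) ^ 2 := by gcongr; exact hle t ht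
      _ ≤ 2 * B ^ 2 * (‖f t‖ ^ 2 + ‖g t‖ ^ 2) := by
        nlinarith [mul_nonneg (sq_nonneg B) (sq_nonneg (‖f t‖ - ‖g t‖))]
  refine (lt_of_le_of_lt (setLIntegral_mono' hS hpt) ?_).ne
  rw [lintegral_const_mul' _ _ (by finiteness),
    lintegral_add_left' (aemeasurable_weightedSq_integrand hrm hS hf)]
  exact ENNReal.mul_lt_top (by finiteness) (ENNReal.add_lt_top.2 ⟨hf'.lt_top, hg'.lt_top⟩)

/-- A nonnegative function on `I` whose integrals up to `d` are bounded has small integrals near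
the left endpoint of `I`. -/
theorem exists_intervalIntegral_le {R : ℝ → ℝ} {d T ε : ℝ}
    (hR : ∀ x ∈ I, ∀ y ∈ I, IntervalIntegrable R volume x y) (hd : d ∈ I)
    (hT : ∀ x ∈ I, x ≤ d → ∫ t in x..d, R t ≤ T) (hε : 0 < ε) :
    ∃ c ∈ I, c ≤ d ∧ ∀ x ∈ I, x ≤ c → ∫ t in x..c, R t ≤ ε := by
  set S : Set ℝ := (fun x => ∫ t in x..d, R t) '' (I ∩ Iic d)
  have hne : S.Nonempty := ⟨_, d, ⟨hd, le_refl d⟩, rfl⟩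
  have hbdd : BddAbove S := ⟨T, by rintro _ ⟨x, hx, rfl⟩; exact hT x hx.1 hx.2⟩
  obtain ⟨_, ⟨c, hc, rfl⟩, hlt⟩ := exists_lt_of_lt_csSup hne (sub_lt_self (sSup S) hε)
  refine ⟨c, hc.1, hc.2, fun x hx hxc => ?_⟩
  have h1 := le_csSup hbdd ⟨x, ⟨hx, hxc.trans hc.2⟩, rfl⟩
  have h2 := intervalIntegral.integral_add_adjacent_intervals (hR x hx c hc.1)
    (hR c hc.1 d hd)
  beta_reduce at h1 hlt
  linarith

/-- Weyl's alternative: if a fundamental system for spectral parameter `z` is square integrable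
near the left endpoint, then so is every solution for spectral parameter `0`. -/
theorem exists_weightedSq_ne_top [hI : I.OrdConnected] (ho : IsOpen I) (hrm : Measurable r)
    (hr : ∀ x ∈ I, ∀ y ∈ I, IntervalIntegrable r volume x y) (hr0 : ∀ᵐ t, t ∈ I → 0 ≤ r t)
    {P Q : ℝ → 𝕜} {z : 𝕜} {θ θ' φ φ' u v : ℝ → 𝕜}
    (hθ : IsSystemSolution I P (fun t => Q t - z * (r t : 𝕜)) θ θ')
    (hφ : IsSystemSolution I P (fun t => Q t - z * (r t : 𝕜)) φ φ')
    (hu : IsSystemSolution I P Q u v) {d : ℝ} (hd : d ∈ I)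
    (hW : θ d * φ' d - θ' d * φ d = 1) (hθ2 : weightedSq r θ (I ∩ Iio d) ≠ ⊤)
    (hφ2 : weightedSq r φ (I ∩ Iio d) ≠ ⊤) :
    ∃ c ∈ I, weightedSq r u (I ∩ Iio c) ≠ ⊤ := by
  have hθc := hθ.1.continuousOn ho
  have hφc := hφ.1.continuousOn ho
  have huc := hu.1.continuousOn ho
  set m : ℝ → ℝ := fun t => ‖θ t‖ + ‖φ t‖ with hm_def
  have hm0 : ∀ t, 0 ≤ m t := fun t => by positivity
  have hmc : ContinuousOn m I := hθc.norm.add hφc.norm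
  have hm2 : ContinuousOn (fun t => m t ^ 2) I := hmc.pow 2
  have hθn : ContinuousOn (fun t => ‖θ t‖ ^ 2) I := hθc.norm.pow 2
  have hφn : ContinuousOn (fun t => ‖φ t‖ ^ 2) I := hφc.norm.pow 2
  have hint : ∀ {g : ℝ → ℝ}, ContinuousOn g I →
      ∀ x ∈ I, ∀ y ∈ I, IntervalIntegrable (fun t => r t * g t) volume x y :=
    fun hg x hx y hy => (hr x hx y hy).mul_continuousOn (hg.mono (hI.uIcc_subset hx hy))
  have hmono : ∀ {g h : ℝ → ℝ}, ContinuousOn g I → ContinuousOn h I → ∀ {x}, x ∈ I → ∀ {y}, y ∈ I →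
      x ≤ y → (∀ t ∈ Icc x y, g t ≤ h t) →
      ∫ t in x..y, r t * g t ≤ ∫ t in x..y, r t * h t := by
    intro g h hg hh x hx y hy hxy hgh
    refine intervalIntegral.integral_mono_ae_restrict hxy (hint hg x hx y hy) (hint hh x hx y hy)
      ((ae_restrict_iff' measurableSet_Icc).2 (hr0.mono fun t ht htx => ?_))
    exact mul_le_mul_of_nonneg_left (hgh t htx) (ht (hI.out hx hy htx))
  have hT : ∀ x ∈ I, x ≤ d → ∫ t in x..d, r t * m t ^ 2 ≤
      2 * (weightedSq r θ (I ∩ Iio d)).toReal + 2 * (weightedSq r φ (I ∩ Iio d)).toReal := by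
    intro x hx hxd
    have h1 := intervalIntegral_normSq_mul_le hr hr0 hθc hd hθ2 hx hxd
    have h2 := intervalIntegral_normSq_mul_le hr hr0 hφc hd hφ2 hx hxd
    have h3 : ∫ t in x..d, r t * m t ^ 2 ≤
        ∫ t in x..d, r t * (2 * ‖θ t‖ ^ 2 + 2 * ‖φ t‖ ^ 2) := by
      refine hmono hm2 ((hθn.const_mul 2).add (hφn.const_mul 2)) hx hd hxd fun t _ => ?_
      simp only [hm_def, Pi.add_apply]
      nlinarith [sq_nonneg (‖θ t‖ - ‖φ t‖)]
    have h4 : ∫ t in x..d, r t * (2 * ‖θ t‖ ^ 2 + 2 * ‖φ t‖ ^ 2) =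
        2 * (∫ t in x..d, r t * ‖θ t‖ ^ 2) + 2 * ∫ t in x..d, r t * ‖φ t‖ ^ 2 := by
      rw [← intervalIntegral.integral_const_mul, ← intervalIntegral.integral_const_mul,
        ← intervalIntegral.integral_add ((hint hθn x hx d hd).const_mul 2)
          ((hint hφn x hx d hd).const_mul 2)]
      exact intervalIntegral.integral_congr fun t _ => by ring
    linarith
  obtain ⟨c, hc, hcd, hsmall⟩ := exists_intervalIntegral_le (hint hm2) hd hT
    (ε := 1 / (2 * (‖z‖ + 1))) (by positivity)
  have hzε : ‖z‖ * (1 / (2 * (‖z‖ + 1))) ≤ 1 / 2 := by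
    rw [mul_one_div, div_le_div_iff₀ (by positivity) two_pos]
    linarith
  set ε : ℝ := 1 / (2 * (‖z‖ + 1))
  set A : ℝ := ‖u c * φ' c - v c * φ c‖ + ‖u c * θ' c - v c * θ c‖ with hA
  set N : ℝ → ℝ := fun x => ∫ t in x..c, r t * (m t * ‖u t‖) with hN
  have hmu : ContinuousOn (fun t => m t * ‖u t‖) I := hmc.mul huc.norm
  have hpos : ∀ {g : ℝ → ℝ}, (∀ t, 0 ≤ g t) → ∀ {x}, x ∈ I → ∀ {y}, y ∈ I → x ≤ y →
      0 ≤ ∫ t in x..y, r t * g t := by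
    intro g hg x hx y hy hxy
    exact intervalIntegral.integral_nonneg_of_ae_restrict hxy
      ((ae_restrict_iff' measurableSet_Icc).2
        (hr0.mono fun t ht htx => mul_nonneg (ht (hI.out hx hy htx)) (hg t)))
  have coeff : ∀ {ψ ψ' : ℝ → 𝕜},
      IsSystemSolution I P (fun t => Q t - z * (r t : 𝕜)) ψ ψ' → (∀ t, ‖ψ t‖ ≤ m t) →
      ∀ x ∈ I, x ≤ c → ‖u x * ψ' x - v x * ψ x‖ ≤ ‖u c * ψ' c - v c * ψ c‖ + ‖z‖ * N x := by
    intro ψ ψ' hψ hψm x hx hxc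
    have h := ((hu.wronskian hψ) x hx c hc).2
    have h1 : ‖∫ t in x..c, (Q t - z * (r t : 𝕜) - Q t) * (u t * ψ t)‖ ≤ ‖z‖ * N x := by
      rw [hN, ← intervalIntegral.integral_const_mul]
      refine intervalIntegral.norm_integral_le_of_norm_le hxc (hr0.mono fun t ht htx => ?_)
        ((hint hmu x hx c hc).const_mul _)
      have hrt := ht (hI.out hx hc (Ioc_subset_Icc_self htx))
      rw [sub_sub_cancel_left, norm_mul, norm_neg, norm_mul, norm_mul, RCLike.norm_ofReal,
        abs_of_nonneg hrt, mul_assoc]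
      have := hψm t
      calc ‖z‖ * (r t * (‖u t‖ * ‖ψ t‖)) ≤ ‖z‖ * (r t * (‖u t‖ * m t)) := by gcongr
        _ = ‖z‖ * (r t * (m t * ‖u t‖)) := by ring
    beta_reduce at h
    rw [← h] at h1
    rw [norm_sub_rev] at h1
    exact (norm_le_norm_add_norm_sub' _ _).trans (by gcongr)
  have hub : ∀ x ∈ I, x ≤ c → ‖u x‖ ≤ m x * (A + ‖z‖ * N x) := by
    intro x hx hxc
    have h1 := coeff hφ (fun t => le_add_of_nonneg_left (norm_nonneg _)) x hx hxc
    have h2 := coeff hθ (fun t => le_add_of_nonneg_right (norm_nonneg _)) x hx hxc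
    have hWx : θ x * φ' x - θ' x * φ x = 1 := (hθ.wronskian_eq hφ hd hx).trans hW
    have h3 : u x = θ x * (u x * φ' x - v x * φ x) - φ x * (u x * θ' x - v x * θ x) := by
      linear_combination (-u x) * hWx
    have h4 : ‖u x * φ' x - v x * φ x‖ ≤ A + ‖z‖ * N x := h1.trans (by
      rw [hA]
      linarith [norm_nonneg (u c * θ' c - v c * θ c)])
    have h5 : ‖u x * θ' x - v x * θ x‖ ≤ A + ‖z‖ * N x := h2.trans (by
      rw [hA]
      linarith [norm_nonneg (u c * φ' c - v c * φ c)])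
    calc ‖u x‖ ≤ ‖θ x‖ * ‖u x * φ' x - v x * φ x‖ + ‖φ x‖ * ‖u x * θ' x - v x * θ x‖ := by
          conv_lhs => rw [h3]
          exact (norm_sub_le _ _).trans_eq (by rw [norm_mul, norm_mul])
      _ ≤ ‖θ x‖ * (A + ‖z‖ * N x) + ‖φ x‖ * (A + ‖z‖ * N x) := by gcongr
      _ = m x * (A + ‖z‖ * N x) := by rw [hm_def]; ring
  have hN0 : ∀ x ∈ I, x ≤ c → 0 ≤ N x := fun x hx hxc =>
    hpos (fun t => mul_nonneg (hm0 t) (norm_nonneg _)) hx hc hxc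
  have hA0 : 0 ≤ A := by positivity
  have hNb : ∀ x ∈ I, x ≤ c → N x ≤ 2 * A * ε := by
    intro x hx hxc
    have hanti : ∀ t ∈ Icc x c, N t ≤ N x := by
      intro t ht
      have htI := hI.out hx hc ht
      have h1 := intervalIntegral.integral_add_adjacent_intervals
        (hint hmu x hx t htI) (hint hmu t htI c hc)
      have h2 := hpos (fun t => mul_nonneg (hm0 t) (norm_nonneg (u t))) hx htI ht.1
      simp only [hN]
      linarith
    have h1 : N x ≤ ∫ t in x..c, r t * ((A + ‖z‖ * N x) * m t ^ 2) := by
      refine hmono hmu (hm2.const_mul _) hx hc hxc fun t ht => ?_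
      have htI := hI.out hx hc ht
      calc m t * ‖u t‖ ≤ m t * (m t * (A + ‖z‖ * N t)) :=
            mul_le_mul_of_nonneg_left (hub t htI ht.2) (hm0 t)
        _ = (A + ‖z‖ * N t) * m t ^ 2 := by ring
        _ ≤ (A + ‖z‖ * N x) * m t ^ 2 := by
            gcongr
            exact hanti t ht
    have h2 : ∀ B : ℝ, ∫ t in x..c, r t * (B * m t ^ 2) = B * ∫ t in x..c, r t * m t ^ 2 := by
      intro B
      rw [← intervalIntegral.integral_const_mul]
      exact intervalIntegral.integral_congr fun t _ => by ring
    rw [h2] at h1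
    have hNx := hN0 x hx hxc
    have h3 : (A + ‖z‖ * N x) * ∫ t in x..c, r t * m t ^ 2 ≤ (A + ‖z‖ * N x) * ε := by
      gcongr
      exact hsmall x hx hxc
    have h4 : ‖z‖ * ε * N x ≤ 1 / 2 * N x := mul_le_mul_of_nonneg_right hzε hNx
    linarith
  refine ⟨c, hc, ?_⟩
  have hsub : I ∩ Iio c ⊆ I ∩ Iio d := inter_subset_inter_right _ (Iio_subset_Iio hcd)
  refine weightedSq_ne_top_of_norm_le (f := θ) (g := φ) hrm
    (ho.measurableSet.inter measurableSet_Iio) (hθc.mono inter_subset_left)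
    (B := A + ‖z‖ * (2 * A * ε)) (fun t ht => ?_)
    (ne_top_of_le_ne_top hθ2 (lintegral_mono_set hsub))
    (ne_top_of_le_ne_top hφ2 (lintegral_mono_set hsub))
  have htc : t ≤ c := le_of_lt ht.2
  refine (hub t ht.1 htc).trans (mul_le_mul_of_nonneg_left ?_ (hm0 t))
  have := hNb t ht.1 htc
  gcongr

end WeightedSquare

/-! ### Comparison of Sturm–Liouville expressions -/

section Comparison

variable {a b : EReal} {p q r : ℝ → ℝ}

theorem isOpen_IabE : IsOpen (IabE a b) :=
  (isOpen_Ioo (a := a) (b := b)).preimage continuous_coe_real_ereal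

instance ordConnected_IabE : (IabE a b).OrdConnected :=
  ⟨fun _ hx _ hy _ ht => ⟨hx.1.trans_le (EReal.coe_le_coe_iff.2 ht.1),
    (EReal.coe_le_coe_iff.2 ht.2).trans_lt hy.2⟩⟩

theorem IabE_coe_eq {c : ℝ} (hc : c ∈ IabE a b) : IabE a (c : EReal) = IabE a b ∩ Iio c := by
  ext x
  exact ⟨fun hx => ⟨⟨hx.1, hx.2.trans hc.2⟩, EReal.coe_lt_coe_iff.1 hx.2⟩,
    fun hx => ⟨hx.1.1, EReal.coe_lt_coe_iff.2 hx.2⟩⟩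

theorem intervalIntegrable_of_locallyIntegrableOn {E : Type*} [NormedAddCommGroup E] {I : Set ℝ}
    [hI : I.OrdConnected] {f : ℝ → E} (hf : LocallyIntegrableOn f I) :
    ∀ x ∈ I, ∀ y ∈ I, IntervalIntegrable f volume x y := fun _ hx _ hy =>
  (hf.integrableOn_compact_subset (hI.uIcc_subset hx hy) isCompact_uIcc).intervalIntegrable

theorem Hyp21.intervalIntegrable_coeff (h : Hyp21 a b p q r) (𝕜 : Type*) [RCLike 𝕜] (z : 𝕜) :
    (∀ x ∈ IabE a b, ∀ y ∈ IabE a b,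
      IntervalIntegrable (fun t => ((1 / p t : ℝ) : 𝕜)) volume x y) ∧
    ∀ x ∈ IabE a b, ∀ y ∈ IabE a b,
      IntervalIntegrable (fun t => (q t : 𝕜) - z * (r t : 𝕜)) volume x y := by
  have cast : ∀ {f : ℝ → ℝ}, LocallyIntegrableOn f (IabE a b) →
      ∀ x ∈ IabE a b, ∀ y ∈ IabE a b, IntervalIntegrable (fun t => (f t : 𝕜)) volume x y :=
    fun hf _ hx _ hy =>
      have h := intervalIntegrable_of_locallyIntegrableOn hf _ hx _ hy
      ⟨h.1.ofReal, h.2.ofReal⟩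
  exact ⟨cast h.invp_loc, fun x hx y hy =>
    (cast h.q_loc x hx y hy).sub ((cast h.r_loc x hx y hy).const_mul z)⟩

theorem Hyp21.isSolution3C_iff (h : Hyp21 a b p q r) {z : ℂ} {u v : ℝ → ℂ} :
    IsSolution3C a b p q r z u v ↔ IsSystemSolution (IabE a b) (fun t => ((1 / p t : ℝ) : ℂ))
      (fun t => (q t : ℂ) - z * (r t : ℂ)) u v := by
  obtain ⟨hP, hQ⟩ := h.intervalIntegrable_coeff ℂ z
  have e : ∀ t, v t / (p t : ℂ) = ((1 / p t : ℝ) : ℂ) * v t := fun t => by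
    push_cast
    ring
  simp only [IsSolution3C, e]
  exact ⟨fun hs => isSystemSolution_of_integral_eq hP hQ (fun x hx y hy => (hs y hy x hx).1)
      fun x hx y hy => (hs y hy x hx).2,
    fun hs x hx y hy => ⟨sub_eq_iff_eq_add'.1 (hs.1 y hy x hx).2,
      sub_eq_iff_eq_add'.1 (hs.2 y hy x hx).2⟩⟩

theorem Hyp21.isSolution3R_zero_iff (h : Hyp21 a b p q r) {u v : ℝ → ℝ} :
    IsSolution3R a b p q r 0 u v ↔
      IsSystemSolution (IabE a b) (fun t => 1 / p t) q u v := by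
  have hP := intervalIntegrable_of_locallyIntegrableOn h.invp_loc
  have hQ := intervalIntegrable_of_locallyIntegrableOn h.q_loc
  have e : ∀ t, v t / p t = 1 / p t * v t := fun t => by ring
  simp only [IsSolution3R, e, zero_mul, sub_zero]
  exact ⟨fun hs => isSystemSolution_of_integral_eq hP hQ (fun x hx y hy => (hs y hy x hx).1)
      fun x hx y hy => (hs y hy x hx).2,
    fun hs x hx y hy => ⟨sub_eq_iff_eq_add'.1 (hs.1 y hy x hx).2,
      sub_eq_iff_eq_add'.1 (hs.2 y hy x hx).2⟩⟩

/-- A continuous function with finitely many zeros near the left endpoint of an open interval has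
constant sign there. -/
theorem exists_pos_or_neg_of_finite_zeros {I : Set ℝ} [hI : I.OrdConnected] (ho : IsOpen I)
    {u : ℝ → ℝ} (hu : ContinuousOn u I) {c : ℝ} (hc : c ∈ I)
    (hfin : {x ∈ I ∩ Iio c | u x = 0}.Finite) :
    ∃ d ∈ I, (∀ t ∈ I, t ≤ d → 0 < u t) ∨ ∀ t ∈ I, t ≤ d → u t < 0 := by
  have below : ∀ x ∈ I, ∃ y ∈ I, y < x := fun x hx => by
    obtain ⟨y, hyx, hy⟩ := exists_Ioc_subset_of_mem_nhds (ho.mem_nhds hx) (exists_lt x)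
    obtain ⟨s, hs⟩ := exists_between hyx
    exact ⟨s, hy ⟨hs.1, hs.2.le⟩, hs.2⟩
  obtain ⟨d, hd, hd0⟩ : ∃ d ∈ I, ∀ t ∈ I, t ≤ d → u t ≠ 0 := by
    rcases eq_empty_or_nonempty {x ∈ I ∩ Iio c | u x = 0} with h | h
    · obtain ⟨d, hd, hdc⟩ := below c hc
      exact ⟨d, hd, fun t ht htd h0 => h.subset ⟨⟨ht, htd.trans_lt hdc⟩, h0⟩⟩
    · obtain ⟨m, hm, hmin⟩ := exists_min_image _ id hfin h
      obtain ⟨d, hd, hdm⟩ := below m hm.1.1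
      exact ⟨d, hd, fun t ht htd h0 => absurd
        (hmin t ⟨⟨ht, (htd.trans_lt hdm).trans hm.1.2⟩, h0⟩) (not_le.2 (htd.trans_lt hdm))⟩
  have ivt : ∀ t ∈ I, t ≤ d → (0 : ℝ) ∉ uIcc (u t) (u d) := fun t ht htd h0 => by
    obtain ⟨s, hs, hs0⟩ := intermediate_value_uIcc (hu.mono (hI.uIcc_subset ht hd)) h0
    rw [uIcc_of_le htd] at hs
    exact hd0 s (hI.out ht hd hs) hs.2 hs0
  refine ⟨d, hd, (lt_or_gt_of_ne (hd0 d hd le_rfl)).symm.imp (fun h t ht htd => ?_)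
    fun h t ht htd => ?_⟩
  · by_contra! hle
    exact ivt t ht htd (mem_uIcc.2 (Or.inl ⟨hle, le_of_lt h⟩))
  · by_contra! hle
    exact ivt t ht htd (mem_uIcc.2 (Or.inr ⟨le_of_lt h, hle⟩))

theorem NonoscillatoryAtA.exists_pos (h : Hyp21 a b p q r) (hn : NonoscillatoryAtA a b p q r) :
    ∃ u v : ℝ → ℝ, IsSystemSolution (IabE a b) (fun t => 1 / p t) q u v ∧
      ∃ d ∈ IabE a b, ∀ t ∈ IabE a b, t ≤ d → 0 < u t := by
  obtain ⟨u, v, hs, -, c, hc, hfin⟩ := hn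
  rw [h.isSolution3R_zero_iff] at hs
  rw [IabE_coe_eq hc] at hfin
  obtain ⟨d, hd, hpos | hneg⟩ :=
    exists_pos_or_neg_of_finite_zeros isOpen_IabE (hs.1.continuousOn isOpen_IabE) hc hfin
  · exact ⟨u, v, hs, d, hd, hpos⟩
  · exact ⟨_, _, hs.neg, d, hd, fun t ht htd => neg_pos.2 (hneg t ht htd)⟩

/-- In the limit point case some real solution of `τ u = 0` is not square integrable near the left
endpoint. -/
theorem LimitPointAtA.exists_real (h : Hyp21 a b p q r) (hl : LimitPointAtA a b p q r) :
    ∃ w y : ℝ → ℝ, IsSystemSolution (IabE a b) (fun t => 1 / p t) q w y ∧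
      ∃ c ∈ IabE a b, weightedSq r w (IabE a b ∩ Iio c) = ⊤ := by
  obtain ⟨u, v, hs, c, hc, htop⟩ := hl 0
  rw [h.isSolution3C_iff] at hs
  rw [IabE_coe_eq hc] at htop
  have part : ∀ L : ℂ →L[ℝ] ℝ, (∀ (s : ℝ) (w : ℂ), L (s * w) = s * L w) →
      IsSystemSolution (IabE a b) (fun t => 1 / p t) q (fun t => L (u t)) (fun t => L (v t)) :=
    fun L hL => ⟨(hs.1.clm_comp L).congr fun t => hL _ _,
      (hs.2.clm_comp L).congr fun t => by simp only [zero_mul, sub_zero, hL]⟩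
  have hre := part Complex.reCLM fun s w => by simp
  have him := part Complex.imCLM fun s w => by simp
  by_contra! hcon
  refine weightedSq_ne_top_of_norm_le (r := r) (u := u) (B := 1) h.r_meas
    (isOpen_IabE.measurableSet.inter measurableSet_Iio)
    ((hre.1.continuousOn isOpen_IabE).mono inter_subset_left) (fun t _ => ?_)
    (hcon _ _ hre c hc) (hcon _ _ him c hc) htop
  rw [mul_one]
  exact Complex.norm_le_abs_re_add_abs_im _

/-- If `τ u = 0` has a positive solution near the left endpoint, then in the limit point case it
has one that is not square integrable. -/
theorem LimitPointAtA.exists_pos (h : Hyp21 a b p q r) (hn : NonoscillatoryAtA a b p q r)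
    (hl : LimitPointAtA a b p q r) :
    ∃ w y : ℝ → ℝ, IsSystemSolution (IabE a b) (fun t => 1 / p t) q w y ∧
      ∃ e ∈ IabE a b, (∀ t ∈ IabE a b, t ≤ e → 0 < w t) ∧
        weightedSq r w (IabE a b ∩ Iio e) = ⊤ := by
  have hP : ∀ᵐ t, t ∈ IabE a b → 0 ≤ 1 / p t :=
    h.p_pos.mono fun t ht htI => (one_div_pos.2 (ht htI)).le
  obtain ⟨u, v, hu, d, hd, hpos⟩ := hn.exists_pos h
  obtain ⟨w, y, hw, c, hc, htop⟩ := hl.exists_real h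
  obtain ⟨e, he, hsign⟩ := hu.eventually_sign hw hP hd hpos
  have htop_e := weightedSq_Iio_eq_top (intervalIntegrable_of_locallyIntegrableOn h.r_loc)
    (hw.1.continuousOn isOpen_IabE) hc he htop
  rcases hsign with hw_pos | hw_neg | hw_zero
  · exact ⟨w, y, hw, e, he, hw_pos, htop_e⟩
  · refine ⟨_, _, hw.neg, e, he, fun t ht hte => neg_pos.2 (hw_neg t ht hte), ?_⟩
    simpa only [weightedSq, nnnorm_neg] using htop_e
  · have h0 : weightedSq r w (IabE a b ∩ Iio e) = 0 := by
      refine (setLIntegral_congr_fun (isOpen_IabE.measurableSet.inter measurableSet_Iio)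
        (g := fun _ => 0) fun t ht => ?_).trans lintegral_zero
      simp [hw_zero t ht.1 (le_of_lt ht.2)]
    simp [h0] at htop_e

/-- By Weyl's alternative, the limit point case is decided by the real solutions of
`τ u = 0`. -/
theorem limitPointAtA_of_weightedSq_eq_top (h : Hyp21 a b p q r) {u v : ℝ → ℝ}
    (hu : IsSystemSolution (IabE a b) (fun t => 1 / p t) q u v) {e : ℝ} (he : e ∈ IabE a b)
    (htop : weightedSq r u (IabE a b ∩ Iio e) = ⊤) : LimitPointAtA a b p q r := by
  intro z
  by_contra! hcon
  have hr := intervalIntegrable_of_locallyIntegrableOn h.r_loc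
  have hfin : ∀ f g : ℝ → ℂ, IsSystemSolution (IabE a b) (fun t => ((1 / p t : ℝ) : ℂ))
      (fun t => (q t : ℂ) - z * (r t : ℂ)) f g → weightedSq r f (IabE a b ∩ Iio e) ≠ ⊤ :=
    fun f g hfg => IabE_coe_eq he ▸ hcon f g (h.isSolution3C_iff.2 hfg) e he
  obtain ⟨hP, hQ⟩ := h.intervalIntegrable_coeff ℂ z
  obtain ⟨θ, θ', hθ, hθe, hθe'⟩ := exists_isSystemSolution hP hQ he 1 0
  obtain ⟨φ, φ', hφ, hφe, hφe'⟩ := exists_isSystemSolution hP hQ he 0 1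
  have huC : IsSystemSolution (IabE a b) (fun t => ((1 / p t : ℝ) : ℂ)) (fun t => (q t : ℂ))
      (fun t => (u t : ℂ)) (fun t => (v t : ℂ)) :=
    ⟨(hu.1.clm_comp Complex.ofRealCLM).congr fun t => by simp,
      (hu.2.clm_comp Complex.ofRealCLM).congr fun t => by simp⟩
  obtain ⟨c, hc, hne⟩ := exists_weightedSq_ne_top isOpen_IabE h.r_meas hr
    (h.r_pos.mono fun t ht htI => (ht htI).le) hθ hφ huC he
    (by rw [hθe, hθe', hφe, hφe']; ring) (hfin θ θ' hθ) (hfin φ φ' hφ)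
  refine hne (weightedSq_Iio_eq_top hr (huC.1.continuousOn isOpen_IabE) he hc ?_)
  simpa only [weightedSq, Complex.nnnorm_real] using htop

end Comparison

theorem statement5 (a b : EReal) (p q₁ q₂ r : ℝ → ℝ)
    (hyp₁ : Hyp21 a b p q₁ r) (hyp₂ : Hyp21 a b p q₂ r)
    (hosc₁ : NonoscillatoryAtA a b p q₁ r)
    (hlp₁ : LimitPointAtA a b p q₁ r)
    (hq : ∀ᵐ x : ℝ, x ∈ IabE a b → q₁ x ≤ q₂ x) :
    NonoscillatoryAtA a b p q₂ r ∧ LimitPointAtA a b p q₂ r := by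
  have hP : ∀ᵐ t, t ∈ IabE a b → 0 ≤ 1 / p t :=
    hyp₁.p_pos.mono fun t ht htI => (one_div_pos.2 (ht htI)).le
  obtain ⟨w, y, hw, e, he, hpos, htop⟩ := hlp₁.exists_pos hyp₁ hosc₁
  obtain ⟨u, v, hu, hue, hve⟩ := exists_isSystemSolution
    (intervalIntegrable_of_locallyIntegrableOn hyp₂.invp_loc)
    (intervalIntegrable_of_locallyIntegrableOn hyp₂.q_loc) he (w e) (y e)
  have hle : ∀ t ∈ IabE a b, t ≤ e → w t ≤ u t := fun t ht hte =>
    hw.le_of_potential_le hu hP hq he hpos hue hve ht hte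
  have hu_pos : ∀ t ∈ IabE a b, t ≤ e → 0 < u t := fun t ht hte =>
    (hpos t ht hte).trans_le (hle t ht hte)
  refine ⟨⟨u, v, hyp₂.isSolution3R_zero_iff.2 hu,
    fun h0 => (hu_pos e he le_rfl).ne' (h0 e he).1, e, he, ?_⟩,
    limitPointAtA_of_weightedSq_eq_top hyp₂ hu he (top_le_iff.1 (htop ▸ ?_))⟩
  · rw [IabE_coe_eq he]
    refine finite_empty.subset fun t ht => ?_
    exact (hu_pos t ht.1.1 (le_of_lt ht.1.2)).ne' ht.2
  · refine setLIntegral_mono' (isOpen_IabE.measurableSet.inter measurableSet_Iio) fun t ht => ?_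
    have hte : t ≤ e := le_of_lt ht.2
    gcongr
    rw [← NNReal.coe_le_coe, coe_nnnorm, coe_nnnorm, Real.norm_of_nonneg (hpos t ht.1 hte).le,
      Real.norm_of_nonneg (hu_pos t ht.1 hte).le]
    exact hle t ht.1 hte
end
end
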